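/- (Gitik–Shelah) If κ is a strong cardinal, then LD^strong_κ holds: there is a partial function ℓ : κ ⇀ V_κ such that for every ordinal θ and every set A ∈ V_θ there is a θ-strongness embedding j : V → M with critical point κ such that j(ℓ)(κ) = A. -/

import Mathlib

open FirstOrder

universe u

namespace LaverDiamond

/-- The relation symbols of the language of set theory: a single binary relation `mem`. -/
inductive memRel : ℕ → Type
  | mem : memRel 2

/-- The first-order language of set theory. -/
def SetLang : FirstOrder.Language := ⟨fun _ => Empty, memRel⟩

/-- Any class of ZF-sets is a structure in the language of set theory, with the true
membership relation. -/
instance classStructure (M : Set ZFSet.{u}) : SetLang.Structure M where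
  funMap := fun {_} f _ => f.elim
  RelMap := fun {_} r x => match r with
    | .mem => (x 0 : ZFSet) ∈ (x 1 : ZFSet)

/-- A (fully) elementary embedding from the class `M` to the class `N`, both classes of
ZF-sets equipped with the true membership relation.  It is coded by a global function
`j : ZFSet → ZFSet` mapping `M` into `N`, elementary for all first-order formulas
with parameters from `M`. -/
structure ClassEmb (M N : Set ZFSet.{u}) where
  j : ZFSet.{u} → ZFSet.{u}
  maps : ∀ x, x ∈ M → j x ∈ N
  elem : ∀ {n : ℕ} (φ : SetLang.Formula (Fin n)) (v : Fin n → ZFSet.{u}) (hv : ∀ i, v i ∈ M),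
    φ.Realize (fun i => (⟨v i, hv i⟩ : M)) ↔ φ.Realize (fun i => (⟨j (v i), maps _ (hv i)⟩ : N))

/-- The universe of all ZF-sets, as a class. -/
def V : Set ZFSet.{u} := Set.univ

/-- A transitive class of ZF-sets. -/
def TransClass (M : Set ZFSet.{u}) : Prop := ∀ x ∈ M, ∀ y ∈ x, y ∈ M

/-- `j` has critical point `κ`: `κ` is an ordinal, fixed below `κ`, with `j(κ) > κ`. -/
def CritPt (j : ZFSet.{u} → ZFSet.{u}) (κ : ZFSet.{u}) : Prop :=
  κ.IsOrdinal ∧ κ ∈ j κ ∧ ∀ α : ZFSet, α.IsOrdinal → α ∈ κ → j α = α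

/-- `x` is a member of the rank-initial segment `V_θ`. -/
def MemV (θ x : ZFSet.{u}) : Prop := x.rank < θ.rank

/-- `κ` is a cardinal: an ordinal not equinumerous with any smaller ordinal. -/
def IsCard (κ : ZFSet.{u}) : Prop :=
  κ.IsOrdinal ∧ ∀ β ∈ κ, Cardinal.mk β.toSet < Cardinal.mk κ.toSet

/-- `x ∈ H(θ⁺)`, i.e. `x` has hereditary size at most `θ`. -/
def MemH (θ x : ZFSet.{u}) : Prop :=
  ∃ t : ZFSet, t.IsTransitive ∧ x ∈ t ∧ Cardinal.mk t.toSet ≤ Cardinal.mk θ.toSet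

/-- `f` is a set-function with domain `θ` taking values in the class `M`. -/
def IsFuncInto (θ : ZFSet.{u}) (M : Set ZFSet.{u}) (f : ZFSet.{u}) : Prop :=
  (∀ p ∈ f, ∃ a b : ZFSet, a ∈ θ ∧ b ∈ M ∧ p = ZFSet.pair a b) ∧
  ∀ a ∈ θ, ∃! b : ZFSet, ZFSet.pair a b ∈ f

/-- The class `M` is closed under `θ`-sequences: `M^θ ⊆ M`. -/
def SeqClosed (θ : ZFSet.{u}) (M : Set ZFSet.{u}) : Prop :=
  ∀ f : ZFSet, IsFuncInto θ M f → f ∈ M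

/-- The set `M` is closed under `<κ`-sequences: `M^{<κ} ⊆ M`. -/
def SeqClosedLt (κ M : ZFSet.{u}) : Prop :=
  ∀ α : ZFSet, α ∈ κ → ∀ f : ZFSet, IsFuncInto α M.toSet f → f ∈ M

/-- `ℓ` is a partial function from `κ` to `V_κ` (coded as a set of Kuratowski pairs). -/
def IsPFun (κ ℓ : ZFSet.{u}) : Prop :=
  (∀ p ∈ ℓ, ∃ γ A : ZFSet, γ ∈ κ ∧ MemV κ A ∧ p = ZFSet.pair γ A) ∧
  ∀ γ A B : ZFSet, ZFSet.pair γ A ∈ ℓ → ZFSet.pair γ B ∈ ℓ → A = B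

/-- The set `r` is the restriction to `κ` of the class function `ℓ` (defined on the
ordinals below `κ`), coded as a set of Kuratowski pairs. -/
def RestrictEq (ℓ : ZFSet.{u} → ZFSet.{u}) (κ r : ZFSet.{u}) : Prop :=
  ∀ p : ZFSet, p ∈ r ↔ ∃ γ : ZFSet, γ ∈ κ ∧ p = ZFSet.pair γ (ℓ γ)

/-- The set `r` is the restriction to `κ` of the class function `ℓ` restricted further to
the class `D`. -/
def RestrictEqOn (ℓ : ZFSet.{u} → ZFSet.{u}) (D : Set ZFSet.{u}) (κ r : ZFSet.{u}) : Prop :=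
  ∀ p : ZFSet, p ∈ r ↔ ∃ γ : ZFSet, γ ∈ κ ∧ γ ∈ D ∧ p = ZFSet.pair γ (ℓ γ)

/-- The set `r` is the restriction to `δ` of the set partial function `ℓ`. -/
def RestrictSet (ℓ δ r : ZFSet.{u}) : Prop :=
  ∀ p : ZFSet, p ∈ r ↔ p ∈ ℓ ∧ ∃ γ A : ZFSet, γ ∈ δ ∧ p = ZFSet.pair γ A

/-! ### Supercompactness -/

/-- A `θ`-supercompactness embedding with critical point `κ`: an elementary embedding
`j : V → M` with `M` a transitive class closed under `θ`-sequences and `j(κ) > θ`. -/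
structure SCEmb (κ θ : ZFSet.{u}) where
  M : Set ZFSet.{u}
  trans : TransClass M
  e : ClassEmb V M
  crit : CritPt e.j κ
  closed : SeqClosed θ M
  big : θ ∈ e.j κ

/-- `κ` is `θ`-supercompact. -/
def SCAt (κ θ : ZFSet.{u}) : Prop := Nonempty (SCEmb κ θ)

/-- `κ` is supercompact: `θ`-supercompact for every cardinal `θ`. -/
def Supercompact (κ : ZFSet.{u}) : Prop := ∀ θ : ZFSet, IsCard θ → SCAt κ θ

/-- `ℓ` is a Laver function witnessing the Laver diamond `LD^sc_κ`. -/
def LDscFun (κ ℓ : ZFSet.{u}) : Prop :=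
  IsPFun κ ℓ ∧ ∀ θ A : ZFSet, IsCard θ → MemH θ A →
    ∃ E : SCEmb κ θ, ZFSet.pair κ A ∈ E.e.j ℓ

/-- The Laver diamond principle `LD^sc_κ`. -/
def LDsc (κ : ZFSet.{u}) : Prop := ∃ ℓ : ZFSet, LDscFun κ ℓ

/-- A universal `LD^sc` Laver function. -/
def UnivLDsc (ℓ : ZFSet.{u} → ZFSet.{u}) : Prop :=
  ∀ κ : ZFSet, Supercompact κ → ∃ r : ZFSet, RestrictEq ℓ κ r ∧ LDscFun κ r

/-! ### Strongness -/

/-- A `θ`-strongness embedding with critical point `κ`: an elementary `j : V → M` with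
`M` a transitive class and `V_θ ⊆ M`. -/
structure StrEmb (κ θ : ZFSet.{u}) where
  M : Set ZFSet.{u}
  trans : TransClass M
  e : ClassEmb V M
  crit : CritPt e.j κ
  vsub : ∀ x : ZFSet, MemV θ x → x ∈ M

/-- `κ` is `θ`-strong. -/
def StrongAt (κ θ : ZFSet.{u}) : Prop := Nonempty (StrEmb κ θ)

/-- `κ` is a strong cardinal. -/
def Strong (κ : ZFSet.{u}) : Prop := ∀ θ : ZFSet, θ.IsOrdinal → StrongAt κ θ

/-- `ℓ` witnesses the Laver diamond `LD^strong_κ`. -/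
def LDstrongFun (κ ℓ : ZFSet.{u}) : Prop :=
  IsPFun κ ℓ ∧ ∀ θ A : ZFSet, θ.IsOrdinal → MemV θ A →
    ∃ E : StrEmb κ θ, ZFSet.pair κ A ∈ E.e.j ℓ

/-- The Laver diamond principle `LD^strong_κ`. -/
def LDstrong (κ : ZFSet.{u}) : Prop := ∃ ℓ : ZFSet, LDstrongFun κ ℓ

/-- A universal `LD^strong` Laver function. -/
def UnivLDstrong (ℓ : ZFSet.{u} → ZFSet.{u}) : Prop :=
  ∀ κ : ZFSet, Strong κ → ∃ r : ZFSet, RestrictEq ℓ κ r ∧ LDstrongFun κ r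

/-! ### Measurability -/

/-- An embedding witnessing measurability of `κ`: an elementary `j : V → M`
with `M` a transitive class and critical point `κ`. -/
structure MeasEmb (κ : ZFSet.{u}) where
  M : Set ZFSet.{u}
  trans : TransClass M
  e : ClassEmb V M
  crit : CritPt e.j κ

/-- `κ` is a measurable cardinal. -/
def MeasurableCard (κ : ZFSet.{u}) : Prop := Nonempty (MeasEmb κ)

/-- `ℓ` witnesses the Laver diamond `LD^meas_κ`. -/
def LDmeasFun (κ ℓ : ZFSet.{u}) : Prop :=
  IsPFun κ ℓ ∧ ∀ A : ZFSet, MemH κ A → ∃ E : MeasEmb κ, ZFSet.pair κ A ∈ E.e.j ℓ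

/-- The Laver diamond principle `LD^meas_κ`. -/
def LDmeas (κ : ZFSet.{u}) : Prop := ∃ ℓ : ZFSet, LDmeasFun κ ℓ

/-- A universal `LD^meas` Laver function. -/
def UnivLDmeas (ℓ : ZFSet.{u} → ZFSet.{u}) : Prop :=
  ∀ κ : ZFSet, MeasurableCard κ → ∃ r : ZFSet, RestrictEq ℓ κ r ∧ LDmeasFun κ r

/-! ### Weak compactness -/

/-- `κ` is weakly compact: every transitive set `M` of size `κ` with `κ ∈ M` admits an
elementary embedding `j : M → N` into a transitive set `N` with critical point `κ`. -/
def WeaklyCompact (κ : ZFSet.{u}) : Prop :=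
  ∀ M : ZFSet, M.IsTransitive → Cardinal.mk M.toSet = Cardinal.mk κ.toSet → κ ∈ M →
    ∃ N : ZFSet, N.IsTransitive ∧ ∃ e : ClassEmb M.toSet N.toSet, CritPt e.j κ

/-- `ℓ` witnesses the Laver diamond `LD^wc_κ`. -/
def LDwcFun (κ ℓ : ZFSet.{u}) : Prop :=
  IsPFun κ ℓ ∧ ∀ A M : ZFSet, MemH κ A →
    M.IsTransitive → Cardinal.mk M.toSet = Cardinal.mk κ.toSet → κ ∈ M → A ∈ M → ℓ ∈ M →
    ∃ N : ZFSet, N.IsTransitive ∧ ∃ e : ClassEmb M.toSet N.toSet,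
      CritPt e.j κ ∧ ZFSet.pair κ A ∈ e.j ℓ

/-- The Laver diamond principle `LD^wc_κ`. -/
def LDwc (κ : ZFSet.{u}) : Prop := ∃ ℓ : ZFSet, LDwcFun κ ℓ

/-- A universal `LD^wc` Laver function. -/
def UnivLDwc (ℓ : ZFSet.{u} → ZFSet.{u}) : Prop :=
  ∀ κ : ZFSet, WeaklyCompact κ → ∃ r : ZFSet, RestrictEq ℓ κ r ∧ LDwcFun κ r

/-! ### Nice structures and unfoldability -/

/-- `M` is a nice structure for `κ`: a transitive set of size `κ`, closed under
`<κ`-sequences, with `κ ∈ M`. -/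
def Nice (κ M : ZFSet.{u}) : Prop :=
  M.IsTransitive ∧ Cardinal.mk M.toSet = Cardinal.mk κ.toSet ∧ SeqClosedLt κ M ∧ κ ∈ M

/-- `κ` is unfoldable: for every ordinal `θ`, every nice structure admits a
`θ`-unfoldability embedding. -/
def Unfoldable (κ : ZFSet.{u}) : Prop :=
  ∀ θ M : ZFSet, θ.IsOrdinal → Nice κ M →
    ∃ N : ZFSet, N.IsTransitive ∧ ∃ e : ClassEmb M.toSet N.toSet, CritPt e.j κ ∧ θ ∈ e.j κ

/-- `ℓ` witnesses the Laver diamond `LD^unf_κ`. -/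
def LDunfFun (κ ℓ : ZFSet.{u}) : Prop :=
  IsPFun κ ℓ ∧ ∀ θ A M : ZFSet, θ.IsOrdinal → MemH κ A →
    M.IsTransitive → Cardinal.mk M.toSet = Cardinal.mk κ.toSet → SeqClosedLt κ M →
    κ ∈ M → ℓ ∈ M → A ∈ M →
    ∃ N : ZFSet, N.IsTransitive ∧ ∃ e : ClassEmb M.toSet N.toSet,
      CritPt e.j κ ∧ θ ∈ e.j κ ∧ ZFSet.pair κ A ∈ e.j ℓ

/-- The Laver diamond principle `LD^unf_κ`. -/
def LDunf (κ : ZFSet.{u}) : Prop := ∃ ℓ : ZFSet, LDunfFun κ ℓ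

/-- `ℓ` witnesses the Laver diamond `LD^sunf_κ` for strong unfoldability. -/
def LDsunfFun (κ ℓ : ZFSet.{u}) : Prop :=
  IsPFun κ ℓ ∧ ∀ θ A M : ZFSet, IsCard θ → MemH θ A →
    M.IsTransitive → Cardinal.mk M.toSet = Cardinal.mk κ.toSet → SeqClosedLt κ M →
    κ ∈ M → ℓ ∈ M →
    ∃ N : ZFSet, N.IsTransitive ∧ (∀ x : ZFSet, MemV θ x → x ∈ N) ∧
      ∃ e : ClassEmb M.toSet N.toSet, CritPt e.j κ ∧ θ ∈ e.j κ ∧ ZFSet.pair κ A ∈ e.j ℓ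

/-! ### Ramsey cardinals -/

/-- `F` is a weakly amenable `M`-normal measure on `κ`. -/
def MNormalMeasure (κ M F : ZFSet.{u}) : Prop :=
  (∀ X ∈ F, X ⊆ κ ∧ X ∈ M) ∧ κ ∈ F ∧ (∅ : ZFSet) ∉ F ∧
  (∀ X Y : ZFSet, X ∈ F → Y ∈ F → X ∩ Y ∈ F) ∧
  (∀ X Y : ZFSet, X ∈ F → Y ∈ M → X ⊆ Y → Y ⊆ κ → Y ∈ F) ∧
  (∀ X : ZFSet, X ∈ M → X ⊆ κ → (X ∈ F ∨ κ \ X ∈ F)) ∧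
  (∀ ξ ∈ κ, ({ξ} : ZFSet) ∉ F) ∧
  (∀ γ f : ZFSet, γ ∈ κ → f ∈ M → IsFuncInto γ F.toSet f →
    ZFSet.sep (fun ξ => ∀ a X : ZFSet, ZFSet.pair a X ∈ f → ξ ∈ X) κ ∈ F) ∧
  (∀ f : ZFSet, f ∈ M → IsFuncInto κ F.toSet f →
    ZFSet.sep (fun ξ => ∀ a X : ZFSet, ZFSet.pair a X ∈ f → a ∈ ξ → ξ ∈ X) κ ∈ F) ∧
  (∀ D : ZFSet, D ∈ M → MemH κ D → F ∩ D ∈ M)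

/-- `j` is (isomorphic to) the ultrapower map of `M` by the `M`-measure `F` on `κ`, with
transitive (wellfounded) target `N`: `j` is elementary, has critical point `κ`, derives the
measure `F` at `κ`, and every element of `N` has the form `j(f)(κ)` for some function
`f ∈ M` with domain `κ`. -/
def IsUltrapowerMap (κ M F N : ZFSet.{u}) (j : ZFSet.{u} → ZFSet.{u}) : Prop :=
  N.IsTransitive ∧ (∃ e : ClassEmb M.toSet N.toSet, e.j = j) ∧ CritPt j κ ∧
  (∀ X : ZFSet, X ∈ M → X ⊆ κ → (X ∈ F ↔ κ ∈ j X)) ∧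
  (∀ y ∈ N, ∃ f : ZFSet, f ∈ M ∧ (∀ a ∈ κ, ∃! b : ZFSet, ZFSet.pair a b ∈ f) ∧
    ZFSet.pair κ y ∈ j f)

/-- A wellfounded iteration of `⟨M, F⟩` of length `δ`: a commuting system of elementary
embeddings between transitive models, starting at `⟨M, F⟩`, taking ultrapowers by the
image measures at successor steps and direct limits at limit stages. -/
structure Iteration (κ M F δ : ZFSet.{u}) where
  Mod : ZFSet.{u} → ZFSet.{u}
  Meas : ZFSet.{u} → ZFSet.{u}
  cp : ZFSet.{u} → ZFSet.{u}
  emb : ZFSet.{u} → ZFSet.{u} → ZFSet.{u} → ZFSet.{u}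
  mod_zero : Mod ∅ = M
  meas_zero : Meas ∅ = F
  cp_zero : cp ∅ = κ
  trans' : ∀ i : ZFSet, i ∈ δ → (Mod i).IsTransitive
  elem' : ∀ i k : ZFSet, i ∈ δ → k ∈ δ → i ∈ k →
    ∃ e : ClassEmb (Mod i).toSet (Mod k).toSet, e.j = emb i k
  comm : ∀ i k l : ZFSet, i ∈ δ → k ∈ δ → l ∈ δ → i ∈ k → k ∈ l →
    ∀ x ∈ Mod i, emb k l (emb i k x) = emb i l x
  cp_emb : ∀ i : ZFSet, i ∈ δ → i ≠ ∅ → cp i = emb ∅ i κ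
  succ' : ∀ i : ZFSet, i ∈ δ → insert i i ∈ δ →
    IsUltrapowerMap (cp i) (Mod i) (Meas i) (Mod (insert i i)) (emb i (insert i i)) ∧
    (∀ Y : ZFSet, Y ∈ Meas (insert i i) ↔
      ∃ D : ZFSet, D ∈ Mod i ∧ Y ∈ emb i (insert i i) (Meas i ∩ D))
  limit' : ∀ l : ZFSet, l ∈ δ → l ≠ ∅ → (∀ i ∈ l, insert i i ∈ l) →
    (∀ y ∈ Mod l, ∃ i : ZFSet, i ∈ l ∧ ∃ x, x ∈ Mod i ∧ emb i l x = y) ∧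
    (∀ Y : ZFSet, Y ∈ Meas l ↔
      ∃ i : ZFSet, i ∈ l ∧ ∃ D, D ∈ Mod i ∧ Y ∈ emb i l (Meas i ∩ D))

/-- `⟨M, F⟩` is iterable: all its iterations (of any ordinal length) are wellfounded,
i.e. realized by transitive models. -/
def Iterable (κ M F : ZFSet.{u}) : Prop :=
  ∀ δ : ZFSet, δ.IsOrdinal → Nonempty (Iteration κ M F δ)

/-! ### Constructibility -/

/-- `X` is a subset of `M` definable over `⟨M, ∈⟩` with parameters. -/
def DefinableSubset (M X : ZFSet.{u}) : Prop :=
  X ⊆ M ∧ ∃ (n : ℕ) (φ : SetLang.Formula (Fin (n + 1))) (v : Fin n → ZFSet.{u})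
    (hv : ∀ i, v i ∈ M.toSet),
    ∀ a : ZFSet, a ∈ X ↔ ∃ ha : a ∈ M.toSet,
      φ.Realize (Fin.cons (⟨a, ha⟩ : M.toSet) (fun i => (⟨v i, hv i⟩ : M.toSet)))

/-- The set of all subsets of `M` definable over `⟨M, ∈⟩` with parameters. -/
noncomputable def DefSet (M : ZFSet.{u}) : ZFSet.{u} :=
  ZFSet.sep (fun X => DefinableSubset M X) (ZFSet.powerset M)

/-- `h` codes the constructible hierarchy up to `δ`: a function with domain `δ` such that
`h(β) = ⋃_{γ<β} Def(h(γ))` for every `β < δ`. -/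
def IsLHierarchy (δ h : ZFSet.{u}) : Prop :=
  δ.IsOrdinal ∧
  (∀ p ∈ h, ∃ β y : ZFSet, β ∈ δ ∧ p = ZFSet.pair β y) ∧
  (∀ β ∈ δ, ∃! y : ZFSet, ZFSet.pair β y ∈ h) ∧
  ∀ β y : ZFSet, ZFSet.pair β y ∈ h →
    ∀ z : ZFSet, z ∈ y ↔ ∃ γ x : ZFSet, γ ∈ β ∧ ZFSet.pair γ x ∈ h ∧ z ∈ DefSet x

/-- `x` is constructible: it appears at some level of some constructible hierarchy. -/
def Constructible (x : ZFSet.{u}) : Prop :=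
  ∃ δ h β y : ZFSet, IsLHierarchy δ h ∧ ZFSet.pair β y ∈ h ∧ x ∈ y

/-- The axiom of constructibility `V = L`. -/
def VeqL : Prop := ∀ x : ZFSet.{u}, Constructible x

/-! ### Normal measures -/

/-- `U` is a normal measure on `κ`: a `κ`-complete nonprincipal ultrafilter on `κ`
closed under diagonal intersections. -/
def IsNormalMeasure (κ U : ZFSet.{u}) : Prop :=
  (∀ X ∈ U, X ⊆ κ) ∧ κ ∈ U ∧ (∅ : ZFSet) ∉ U ∧
  (∀ X Y : ZFSet, X ∈ U → Y ∈ U → X ∩ Y ∈ U) ∧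
  (∀ X Y : ZFSet, X ∈ U → X ⊆ Y → Y ⊆ κ → Y ∈ U) ∧
  (∀ X : ZFSet, X ⊆ κ → (X ∈ U ∨ κ \ X ∈ U)) ∧
  (∀ ξ ∈ κ, ({ξ} : ZFSet) ∉ U) ∧
  (∀ γ f : ZFSet, γ ∈ κ → IsFuncInto γ U.toSet f →
    ZFSet.sep (fun ξ => ∀ a X : ZFSet, ZFSet.pair a X ∈ f → ξ ∈ X) κ ∈ U) ∧
  (∀ f : ZFSet, IsFuncInto κ U.toSet f →
    ZFSet.sep (fun ξ => ∀ a X : ZFSet, ZFSet.pair a X ∈ f → a ∈ ξ → ξ ∈ X) κ ∈ U)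

end LaverDiamond

open LaverDiamond

/-- A relation between a class `M` and a valuation is first-order definable over transitive
classes. -/
def Dfn {n : ℕ} (Q : Set ZFSet.{u} → (Fin n → ZFSet.{u}) → Prop) : Prop :=
  ∃ φ : SetLang.Formula (Fin n), ∀ M : Set ZFSet.{u}, TransClass M →
    ∀ (v : Fin n → ZFSet.{u}) (hv : ∀ i, v i ∈ M),
      φ.Realize (fun i => (⟨v i, hv i⟩ : M)) ↔ Q M v

namespace Dfn

variable {n : ℕ} {P Q : Set ZFSet.{u} → (Fin n → ZFSet.{u}) → Prop}

theorem mem (i k : Fin n) : Dfn.{u} (fun _ v => v i ∈ v k) := by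
  refine ⟨(Language.Relations.formula₂ (L := SetLang) (show SetLang.Relations 2 from memRel.mem)
    (Language.Term.var i) (Language.Term.var k)), fun M _ v hv => ?_⟩
  rw [Language.Formula.realize_rel₂]
  rfl

theorem eq (i k : Fin n) : Dfn.{u} (fun _ v => v i = v k) := by
  refine ⟨Language.Term.equal (Language.Term.var i) (Language.Term.var k), fun M _ v hv => ?_⟩
  rw [Language.Formula.realize_equal]
  simp

theorem not (h : Dfn P) : Dfn.{u} (fun M v => ¬ P M v) := by
  obtain ⟨φ, hφ⟩ := h
  exact ⟨φ.not, fun M hM v hv => by rw [Language.Formula.realize_not, hφ M hM v hv]⟩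

theorem imp (h : Dfn P) (h' : Dfn Q) : Dfn.{u} (fun M v => P M v → Q M v) := by
  obtain ⟨φ, hφ⟩ := h
  obtain ⟨ψ, hψ⟩ := h'
  exact ⟨φ.imp ψ, fun M hM v hv => by
    rw [Language.Formula.realize_imp, hφ M hM v hv, hψ M hM v hv]⟩

theorem congr (h : Dfn P) (e : ∀ M, TransClass M → ∀ v, (∀ i, v i ∈ M) → (P M v ↔ Q M v)) :
    Dfn Q := by
  obtain ⟨φ, hφ⟩ := h
  exact ⟨φ, fun M hM v hv => (hφ M hM v hv).trans (e M hM v hv)⟩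

theorem and (h : Dfn P) (h' : Dfn Q) : Dfn.{u} (fun M v => P M v ∧ Q M v) :=
  (h.imp h'.not).not.congr fun _ _ _ _ => by tauto

theorem or (h : Dfn P) (h' : Dfn Q) : Dfn.{u} (fun M v => P M v ∨ Q M v) :=
  (h.not.imp h').congr fun _ _ _ _ => by tauto

theorem iff (h : Dfn P) (h' : Dfn Q) : Dfn.{u} (fun M v => P M v ↔ Q M v) :=
  ((h.imp h').and (h'.imp h)).congr fun _ _ _ _ => by tauto

theorem ex {P : Set ZFSet.{u} → (Fin n → ZFSet.{u}) → ZFSet.{u} → Prop}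
    (h : Dfn.{u} (fun M (w : Fin (n + 1) → ZFSet.{u}) => P M (fun i => w i.succ) (w 0))) :
    Dfn.{u} (fun M v => ∃ y ∈ M, P M v y) := by
  obtain ⟨φ, hφ⟩ := h
  refine ⟨Language.Formula.iExs (Fin 1)
    (φ.relabel (Fin.cases (Sum.inr 0) (fun i => Sum.inl i) : Fin (n + 1) → Fin n ⊕ Fin 1)),
    fun M hM v hv => ?_⟩
  rw [Language.Formula.realize_iExs]
  have key : ∀ (y : ZFSet) (hy : y ∈ M) (i : Fin 1 → M), i 0 = ⟨y, hy⟩ →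
      (((φ.relabel (Fin.cases (Sum.inr 0) (fun i => Sum.inl i) :
        Fin (n + 1) → Fin n ⊕ Fin 1))).Realize
        (Sum.elim (fun i => (⟨v i, hv i⟩ : M)) i) ↔ P M v y) := by
    intro y hy i hi
    rw [Language.Formula.realize_relabel]
    have h1 : ∀ k, (Fin.cons y v : Fin (n + 1) → ZFSet) k ∈ M := by
      intro k
      refine Fin.cases ?_ (fun k => ?_) k
      · simpa using hy
      · simpa using hv k
    have := hφ M hM (Fin.cons y v) h1
    simp only [Fin.cons_succ, Fin.cons_zero] at this
    rw [← this]
    apply iff_of_eq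
    congr 1
    funext k
    refine Fin.cases ?_ (fun k => ?_) k
    · simpa using hi
    · simp
  constructor
  · rintro ⟨i, hi⟩
    exact ⟨(i 0).1, (i 0).2, (key _ (i 0).2 i rfl).1 hi⟩
  · rintro ⟨y, hy, h⟩
    exact ⟨fun _ => ⟨y, hy⟩, (key y hy _ rfl).2 h⟩

theorem all {P : Set ZFSet.{u} → (Fin n → ZFSet.{u}) → ZFSet.{u} → Prop}
    (h : Dfn.{u} (fun M (w : Fin (n + 1) → ZFSet.{u}) => P M (fun i => w i.succ) (w 0))) :
    Dfn.{u} (fun M v => ∀ y ∈ M, P M v y) :=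
  (ex (P := fun M v y => ¬ P M v y) h.not).not.congr fun _ _ _ _ => by push Not; rfl

theorem bex {P : Set ZFSet.{u} → (Fin n → ZFSet.{u}) → ZFSet.{u} → Prop} {k : Fin n}
    (h : Dfn.{u} (fun M (w : Fin (n + 1) → ZFSet.{u}) => P M (fun i => w i.succ) (w 0))) :
    Dfn.{u} (fun M v => ∃ y ∈ v k, P M v y) :=
  (ex (P := fun M v y => y ∈ v k ∧ P M v y) ((mem 0 k.succ).and h)).congr
    fun M hM v hv => ⟨fun ⟨y, _, h⟩ => ⟨y, h⟩, fun ⟨y, h, h'⟩ => ⟨y, hM _ (hv k) _ h, h, h'⟩⟩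

theorem ball {P : Set ZFSet.{u} → (Fin n → ZFSet.{u}) → ZFSet.{u} → Prop} {k : Fin n}
    (h : Dfn.{u} (fun M (w : Fin (n + 1) → ZFSet.{u}) => P M (fun i => w i.succ) (w 0))) :
    Dfn.{u} (fun M v => ∀ y ∈ v k, P M v y) :=
  (bex (P := fun M v y => ¬ P M v y) h.not).not.congr fun _ _ _ _ => by push Not; rfl

theorem subset (i k : Fin n) : Dfn.{u} (fun _ v => v i ⊆ v k) :=
  (ball (P := fun M v y => y ∈ v k) (k := i) (mem _ _)).congr fun _ _ _ _ => Iff.rfl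

theorem eq_pair (p a b : Fin n) : Dfn.{u} (fun _ v => v p = ZFSet.pair (v a) (v b)) := by
  have : Dfn.{u} (fun _ v => (∀ z ∈ v p, (v a ∈ z ∧ ∀ y ∈ z, y = v a) ∨
      (v a ∈ z ∧ v b ∈ z ∧ ∀ y ∈ z, y = v a ∨ y = v b)) ∧
      (∃ z ∈ v p, (v a ∈ z ∧ ∀ y ∈ z, y = v a)) ∧
      ∃ z ∈ v p, (v a ∈ z ∧ v b ∈ z ∧ ∀ y ∈ z, y = v a ∨ y = v b)) := by
    apply_rules [and, or, bex, ball, mem, eq]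
  refine this.congr fun M hM v hv => ?_
  have e1 : ∀ z a : ZFSet.{u}, (a ∈ z ∧ ∀ y ∈ z, y = a) ↔ z = {a} := by
    intro z a
    constructor
    · rintro ⟨h1, h2⟩
      ext y
      rw [ZFSet.mem_singleton]
      exact ⟨h2 y, fun h => h ▸ h1⟩
    · rintro rfl
      simp
  have e2 : ∀ z a b : ZFSet.{u}, (a ∈ z ∧ b ∈ z ∧ ∀ y ∈ z, y = a ∨ y = b) ↔ z = {a, b} := by
    intro z a b
    constructor
    · rintro ⟨h1, h1', h2⟩
      ext y
      rw [ZFSet.mem_pair]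
      exact ⟨h2 y, by rintro (h | h) <;> simpa [h]⟩
    · rintro rfl
      simp
  simp only [e1, e2]
  constructor
  · rintro ⟨h1, ⟨_, h2, rfl⟩, ⟨_, h3, rfl⟩⟩
    ext z
    rw [ZFSet.pair, ZFSet.mem_pair]
    exact ⟨h1 z, by rintro (rfl | rfl) <;> assumption⟩
  · intro h
    rw [h]
    simp [ZFSet.pair]

theorem pair_mem (a b p : Fin n) : Dfn.{u} (fun _ v => ZFSet.pair (v a) (v b) ∈ v p) :=
  (bex (P := fun M v y => y = ZFSet.pair (v a) (v b)) (k := p) (eq_pair _ _ _)).congr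
    fun _ _ _ _ => ⟨fun ⟨_, h, e⟩ => e ▸ h, fun h => ⟨_, h, rfl⟩⟩

theorem pair_pair_mem (a b c p : Fin n) :
    Dfn.{u} (fun _ v => ZFSet.pair (ZFSet.pair (v a) (v b)) (v c) ∈ v p) := by
  have : Dfn.{u} (fun _ v => ∃ x ∈ v p, ∃ s ∈ x, ∃ q ∈ s,
      q = ZFSet.pair (v a) (v b) ∧ x = ZFSet.pair q (v c)) := by
    apply_rules [and, or, bex, ball, mem, eq, eq_pair]
  refine this.congr fun M hM v hv => ?_
  constructor
  · rintro ⟨x, hx, s, _, q, _, rfl, rfl⟩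
    exact hx
  · intro h
    exact ⟨_, h, {ZFSet.pair (v a) (v b)}, by simp [ZFSet.pair], _, by simp, rfl, rfl⟩

end Dfn

theorem LaverDiamond.ClassEmb.transfer {M : Set ZFSet.{u}} (e : ClassEmb V.{u} M)
    (hM : TransClass M) {n : ℕ}
    {Q : Set ZFSet.{u} → (Fin n → ZFSet.{u}) → Prop} (h : Dfn Q) (v : Fin n → ZFSet.{u}) :
    Q Set.univ v ↔ Q M (fun i => e.j (v i)) := by
  obtain ⟨φ, hφ⟩ := h
  have h1 := hφ V (fun _ _ _ _ => trivial) v (fun _ => trivial)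
  have h2 := hφ M hM (fun i => e.j (v i)) (fun i => e.maps _ trivial)
  exact h1.symm.trans ((e.elem φ v fun _ => trivial).trans h2)

/-- `E` is an extender over the set `K` with support `U`, coded as the set of pairs `(u, X)`
such that `u` belongs to the image of `X`. -/
structure Extender (E K U : ZFSet.{u}) : Prop where
  sub : ∀ p ∈ E, ∃ u ∈ U, ∃ X, X ⊆ K ∧ p = ZFSet.pair u X
  ultra : ∀ u ∈ U, ∀ X X', X ⊆ K → X' ⊆ K → (∀ x ∈ K, x ∈ X ∨ x ∈ X') →
    ZFSet.pair u X ∈ E ∨ ZFSet.pair u X' ∈ E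
  star : ∀ u X : ℕ → ZFSet.{u}, (∀ n, ZFSet.pair (u n) (X n) ∈ E) →
    ∃ x : ℕ → ZFSet.{u}, (∀ n, x n ∈ K) ∧ (∀ n, x n ∈ X n) ∧ (∀ m n, u m = u n → x m = x n) ∧
      (∀ m n l, u m = ZFSet.pair (u n) (u l) → x m = ZFSet.pair (x n) (x l)) ∧
      (∀ m n, u m ∈ u n → x m ∈ x n) ∧ ∀ n, u n ∈ K → x n = u n
  normal : ∀ R Y, R ⊆ K → Y ⊆ K →
    (∀ p ∈ Y, ∃ x ∈ K, ∃ y ∈ K, ∃ z ∈ K, p = ZFSet.pair x y ∧ z ∈ y ∧ ZFSet.pair x z ∈ R) →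
    ∀ a ∈ U, ∀ u ∈ U, ZFSet.pair (ZFSet.pair a u) Y ∈ E → ∃ v ∈ u, ZFSet.pair (ZFSet.pair a v) R ∈ E

/-- Closure under ordered pairs. -/
def PairClosed (U : ZFSet.{u}) : Prop := ∀ x ∈ U, ∀ y ∈ U, ZFSet.pair x y ∈ U

namespace Extender

/-- Valuations of the seeds `u` that lie in the sets `X` and respect the structure of the seeds. -/
def Good (K : ZFSet.{u}) {ι : Type} (u X : ι → ZFSet.{u}) : Set (ZFSet.{u} → ZFSet.{u}) :=
  {ω | (∀ n, ω (u n) ∈ K) ∧ (∀ n, ω (u n) ∈ X n) ∧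
    (∀ m n l, u m = ZFSet.pair (u n) (u l) → ω (u m) = ZFSet.pair (ω (u n)) (ω (u l))) ∧
    (∀ m n, u m ∈ u n → ω (u m) ∈ ω (u n)) ∧ ∀ n, u n ∈ K → ω (u n) = u n}

theorem Good.comp {K : ZFSet.{u}} {ι κ : Type} {u X : ι → ZFSet.{u}} {ω} (h : ω ∈ Good K u X)
    (f : κ → ι) : ω ∈ Good K (u ∘ f) (X ∘ f) :=
  ⟨fun n => h.1 _, fun n => h.2.1 _, fun m n l => h.2.2.1 _ _ _, fun m n => h.2.2.2.1 _ _,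
    fun n => h.2.2.2.2 _⟩

variable {E K U : ZFSet.{u}}

/-- The sets of valuations containing all good valuations for countably many measure one sets. -/
def IsLarge (E K : ZFSet.{u}) (S : Set (ZFSet.{u} → ZFSet.{u})) : Prop :=
  ∃ u X : ℕ → ZFSet.{u}, (∀ n, ZFSet.pair (u n) (X n) ∈ E) ∧ Good K u X ⊆ S

theorem IsLarge.iInter {S : ℕ → Set (ZFSet.{u} → ZFSet.{u})} (h : ∀ n, IsLarge E K (S n)) :
    IsLarge E K (⋂ n, S n) := by
  choose u X h1 h2 using h
  refine ⟨fun k => u k.unpair.1 k.unpair.2, fun k => X k.unpair.1 k.unpair.2,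
    fun k => h1 _ _, fun ω hω => Set.mem_iInter.2 fun n => h2 n ?_⟩
  have := Good.comp hω (fun k => Nat.pair n k)
  simpa [Function.comp_def] using this

/-- An extender whose space and support are transitive and closed under pairs. -/
structure Nice (E K U : ZFSet.{u}) : Prop where
  ext : Extender E K U
  transK : K.IsTransitive
  transU : U.IsTransitive
  pairK : PairClosed K
  pairU : PairClosed U
  sub : K ⊆ U
  empty : ∅ ∈ K

namespace Nice

theorem full_mem (h : Nice E K U) {u : ZFSet.{u}} (hu : u ∈ U) : ZFSet.pair u K ∈ E := by
  simpa using h.ext.ultra u hu K K (fun _ h => h) (fun _ h => h) (fun x hx => Or.inl hx)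

/-- The filter generated by an extender on the valuations of its seeds. -/
def filter (h : Nice E K U) : Filter (ZFSet.{u} → ZFSet.{u}) where
  sets := {S | IsLarge E K S}
  univ_sets := ⟨fun _ => ∅, fun _ => K, fun _ => h.full_mem (h.sub h.empty), fun _ _ => trivial⟩
  sets_of_superset := fun ⟨u, X, h, h'⟩ hs => ⟨u, X, h, h'.trans hs⟩
  inter_sets := by
    intro S T hS hT
    have := IsLarge.iInter (E := E) (K := K) (S := fun n => if n = 0 then S else T) (by
      intro n
      by_cases hn : n = 0 <;> simpa [hn])
    obtain ⟨u, X, h, h'⟩ := this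
    refine ⟨u, X, h, fun ω hω => ?_⟩
    have h2 := Set.mem_iInter.1 (h' hω)
    exact ⟨by simpa using h2 0, by simpa using h2 1⟩

open Filter

theorem eventually_all_nat (h : Nice E K U) {P : ℕ → (ZFSet.{u} → ZFSet.{u}) → Prop}
    (hP : ∀ n, ∀ᶠ ω in h.filter, P n ω) : ∀ᶠ ω in h.filter, ∀ n, P n ω := by
  have := IsLarge.iInter (E := E) (K := K) (S := fun n => {ω | P n ω}) hP
  rw [← Set.ofPred_forall] at this
  exact this

instance neBot (h : Nice E K U) : h.filter.NeBot := by
  refine ⟨fun hb => ?_⟩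
  have h0 : (∅ : Set (ZFSet.{u} → ZFSet.{u})) ∈ h.filter := by rw [hb]; trivial
  obtain ⟨u, X, hE, hG⟩ := h0
  obtain ⟨x, h1, h2, h3, h4, h5, h6⟩ := h.ext.star u X hE
  classical
  let ω : ZFSet.{u} → ZFSet.{u} := fun v => if hv : ∃ n, u n = v then x hv.choose else ∅
  have key : ∀ n, ω (u n) = x n := by
    intro n
    have hv : ∃ m, u m = u n := ⟨n, rfl⟩
    simp only [ω, dif_pos hv]
    exact h3 _ _ hv.choose_spec
  refine hG (show ω ∈ Good K u X from ⟨?_, ?_, ?_, ?_, ?_⟩) <;> simp only [key] <;> assumption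

theorem mem_seed (h : Nice E K U) {u X : ZFSet.{u}} (hX : ZFSet.pair u X ∈ E) :
    ∀ᶠ ω in h.filter, ω u ∈ X :=
  ⟨fun _ => u, fun _ => X, fun _ => hX, fun ω hω => hω.2.1 0⟩

theorem seed_mem (h : Nice E K U) {u : ZFSet.{u}} (hu : u ∈ U) : ∀ᶠ ω in h.filter, ω u ∈ K :=
  h.mem_seed (h.full_mem hu)

theorem seed_fix (h : Nice E K U) {x : ZFSet.{u}} (hx : x ∈ K) : ∀ᶠ ω in h.filter, ω x = x :=
  ⟨fun _ => x, fun _ => K, fun _ => h.full_mem (h.sub hx), fun ω hω => hω.2.2.2.2 0 hx⟩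

theorem seed_pair (h : Nice E K U) {u v : ZFSet.{u}} (hu : u ∈ U) (hv : v ∈ U) :
    ∀ᶠ ω in h.filter, ω (ZFSet.pair u v) = ZFSet.pair (ω u) (ω v) := by
  refine ⟨fun n => if n = 0 then u else if n = 1 then v else ZFSet.pair u v, fun _ => K,
    fun n => h.full_mem ?_, fun ω hω => ?_⟩
  · dsimp only
    split_ifs
    exacts [hu, hv, h.pairU _ hu _ hv]
  · simpa using hω.2.2.1 2 0 1 (by simp)

theorem seed_lt (h : Nice E K U) {u v : ZFSet.{u}} (hu : u ∈ U) (hv : v ∈ u) :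
    ∀ᶠ ω in h.filter, ω v ∈ ω u := by
  refine ⟨fun n => if n = 0 then u else v, fun _ => K,
    fun n => h.full_mem ?_, fun ω hω => ?_⟩
  · dsimp only
    split_ifs
    exacts [hu, h.transU.mem_trans hv hu]
  · simpa using hω.2.2.2.1 1 0 (by simpa)

theorem mem_or_not (h : Nice E K U) {u : ZFSet.{u}} (hu : u ∈ U) (P : ZFSet.{u} → Prop) :
    ZFSet.pair u (ZFSet.sep P K) ∈ E ∨ ZFSet.pair u (ZFSet.sep (fun x => ¬ P x) K) ∈ E :=
  h.ext.ultra u hu _ _ (fun _ hx => (ZFSet.mem_sep.1 hx).1) (fun _ hx => (ZFSet.mem_sep.1 hx).1)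
    fun x hx => by simpa [hx] using em (P x)

theorem mem_of_eventually (h : Nice E K U) {u X : ZFSet.{u}} (hu : u ∈ U) (hXK : X ⊆ K)
    (hX : ∀ᶠ ω in h.filter, ω u ∈ X) : ZFSet.pair u X ∈ E := by
  have e : ZFSet.sep (fun x => x ∈ X) K = X := by
    ext x
    simpa using fun hx => hXK hx
  have := h.mem_or_not hu (fun x => x ∈ X)
  rw [e] at this
  refine this.resolve_right fun h' => ?_
  obtain ⟨ω, h1, h2⟩ := (hX.and (h.mem_seed h')).exists
  exact (ZFSet.mem_sep.1 h2).2 h1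

theorem decide_seed (h : Nice E K U) {u : ZFSet.{u}} (hu : u ∈ U) (P : ZFSet.{u} → Prop) :
    (∀ᶠ ω in h.filter, P (ω u)) ∨ ∀ᶠ ω in h.filter, ¬ P (ω u) :=
  (h.mem_or_not hu P).imp (fun h' => (h.mem_seed h').mono fun _ h => (ZFSet.mem_sep.1 h).2)
    (fun h' => (h.mem_seed h').mono fun _ h => (ZFSet.mem_sep.1 h).2)

end Nice

/-- Terms for the elements of the ultrapower: a seed together with a function. -/
abbrev Term (U : ZFSet.{u}) : Type (u + 1) := {u : ZFSet.{u} // u ∈ U} × (ZFSet.{u} → ZFSet.{u})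

/-- The value of a term under a valuation of the seeds. -/
def Term.val (ω : ZFSet.{u} → ZFSet.{u}) (a : Term U) : ZFSet.{u} := a.2 (ω a.1.1)

namespace Nice

open Filter

theorem merge (h : Nice E K U) : ∀ {n : ℕ} (a : Fin n → Term U), ∃ u ∈ U,
    ∃ g : Fin n → ZFSet.{u} → ZFSet.{u}, ∀ᶠ ω in h.filter, ∀ i, (a i).val ω = g i (ω u)
  | 0, a => ⟨∅, h.sub h.empty, fun i => i.elim0, Eventually.of_forall fun _ i => i.elim0⟩
  | n + 1, a => by
    obtain ⟨u, hu, g, hg⟩ := h.merge (fun i => a i.succ)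
    classical
    let f1 : ZFSet.{u} → ZFSet.{u} := fun p => if hp : ∃ x y, p = ZFSet.pair x y then hp.choose else ∅
    let f2 : ZFSet.{u} → ZFSet.{u} := fun p =>
      if hp : ∃ x y, p = ZFSet.pair x y then hp.choose_spec.choose else ∅
    have hf : ∀ x y, f1 (ZFSet.pair x y) = x ∧ f2 (ZFSet.pair x y) = y := by
      intro x y
      have hp : ∃ x' y', ZFSet.pair x y = ZFSet.pair x' y' := ⟨x, y, rfl⟩
      have := ZFSet.pair_inj.1 hp.choose_spec.choose_spec
      simp only [f1, f2, dif_pos hp]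
      exact ⟨this.1.symm, this.2.symm⟩
    refine ⟨ZFSet.pair (a 0).1.1 u, h.pairU _ (a 0).1.2 _ hu,
      Fin.cases (fun p => (a 0).2 (f1 p)) (fun i p => g i (f2 p)), ?_⟩
    filter_upwards [hg, h.seed_pair (a 0).1.2 hu] with ω h1 h2 i
    rw [h2]
    refine Fin.cases ?_ (fun i => ?_) i
    · simp [(hf _ _).1, Term.val]
    · simpa [(hf _ _).2] using h1 i

theorem decide_term (h : Nice E K U) {n : ℕ} (a : Fin n → Term U) (P : (Fin n → ZFSet.{u}) → Prop) :
    (∀ᶠ ω in h.filter, P fun i => (a i).val ω) ∨ ∀ᶠ ω in h.filter, ¬ P fun i => (a i).val ω := by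
  obtain ⟨u, hu, g, hg⟩ := h.merge a
  refine (h.decide_seed hu (fun x => P fun i => g i x)).imp (fun h' => ?_) (fun h' => ?_) <;>
  · filter_upwards [h', hg] with ω h1 h2
    simpa only [h2] using h1

theorem choose_term (h : Nice E K U) {n : ℕ} (a : Fin n → Term U)
    (P : (Fin n → ZFSet.{u}) → ZFSet.{u} → Prop)
    (hP : ∀ᶠ ω in h.filter, ∃ y, P (fun i => (a i).val ω) y) :
    ∃ b : Term U, ∀ᶠ ω in h.filter, P (fun i => (a i).val ω) (b.val ω) := by
  obtain ⟨u, hu, g, hg⟩ := h.merge a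
  classical
  refine ⟨⟨⟨u, hu⟩, fun x => if hx : ∃ y, P (fun i => g i x) y then hx.choose else ∅⟩, ?_⟩
  filter_upwards [hP, hg] with ω h1 h2
  simp only [h2] at h1 ⊢
  simp only [Term.val, dif_pos h1]
  exact h1.choose_spec

/-- The membership relation of the ultrapower. -/
def rel (h : Nice E K U) (a b : Term U) : Prop := ∀ᶠ ω in h.filter, a.val ω ∈ b.val ω

theorem rel_wf (h : Nice E K U) : WellFounded h.rel := by
  rw [wellFounded_iff_isEmpty_descending_chain]
  refine ⟨fun ⟨f, hf⟩ => ?_⟩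
  obtain ⟨ω, hω⟩ := (h.eventually_all_nat hf).exists
  exact (wellFounded_iff_isEmpty_descending_chain.1 ZFSet.mem_wf).false
    ⟨fun n => (f n).val ω, hω⟩

end Nice
end Extender

/-- The set with the same elements as a given small class. -/
noncomputable def setOfClass (S : Set ZFSet.{u}) : ZFSet.{u} :=
  open Classical in if h : ∃ z : ZFSet.{u}, ∀ y, y ∈ z ↔ y ∈ S then h.choose else ∅

theorem mem_setOfClass {S : Set ZFSet.{u}} [Small.{u} S] {y : ZFSet.{u}} :
    y ∈ setOfClass S ↔ y ∈ S := by
  have h : ∃ z : ZFSet.{u}, ∀ y, y ∈ z ↔ y ∈ S :=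
    ⟨ZFSet.range (fun x : Shrink.{u} S => ((equivShrink S).symm x : ZFSet.{u})), fun y => by
      rw [ZFSet.mem_range]
      constructor
      · rintro ⟨x, rfl⟩
        exact Subtype.prop _
      · intro hy
        exact ⟨equivShrink S ⟨y, hy⟩, by simp⟩⟩
  rw [setOfClass, dif_pos h]
  exact h.choose_spec y

namespace Extender.Nice
open Filter

variable {E K U : ZFSet.{u}}

/-- The transitive collapse of the ultrapower. -/
noncomputable def collapse (h : Nice E K U) : Term U → ZFSet.{u} :=
  h.rel_wf.fix fun a ih => setOfClass {y | ∃ b, ∃ hb : h.rel b a, y = ih b hb}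

theorem collapse_eq (h : Nice E K U) (a : Term U) :
    h.collapse a = setOfClass {y | ∃ b, h.rel b a ∧ y = h.collapse b} := by
  rw [collapse, WellFounded.fix_eq]
  congr 1
  ext y
  simp only [exists_prop]

/-- Equality in the ultrapower. -/
def equal (h : Nice E K U) (a b : Term U) : Prop := ∀ᶠ ω in h.filter, a.val ω = b.val ω

theorem equal_symm {h : Nice E K U} {a b : Term U} (hab : h.equal a b) : h.equal b a :=
  hab.mono fun _ h => h.symm

theorem rel_congr_right {h : Nice E K U} {a b c : Term U} (hab : h.equal a b) (hc : h.rel c a) :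
    h.rel c b := by
  filter_upwards [hab, hc] with ω h1 h2
  rwa [← h1]

theorem rel_congr_left {h : Nice E K U} {a b c : Term U} (hab : h.equal a b) (hc : h.rel a c) :
    h.rel b c := by
  filter_upwards [hab, hc] with ω h1 h2
  rwa [← h1]

theorem collapse_congr {h : Nice E K U} {a b : Term U} (hab : h.equal a b) :
    h.collapse a = h.collapse b := by
  rw [collapse_eq, collapse_eq]
  congr 1
  ext y
  exact ⟨fun ⟨c, hc, e⟩ => ⟨c, rel_congr_right hab hc, e⟩,
    fun ⟨c, hc, e⟩ => ⟨c, rel_congr_right (equal_symm hab) hc, e⟩⟩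

theorem small_rel (h : Nice E K U) (a : Term U) :
    Small.{u} {y | ∃ b, h.rel b a ∧ y = h.collapse b} := by
  classical
  let T : ZFSet.{u} := insert ∅ (ZFSet.sUnion (ZFSet.range fun x : K => a.2 x))
  have hT : (∅ : ZFSet.{u}) ∈ T := by simp [T]
  let F : (U × (K → T)) → ZFSet.{u} := fun p =>
    h.collapse ⟨⟨p.1, p.1.2⟩, fun x => if hx : x ∈ K then p.2 ⟨x, hx⟩ else ∅⟩
  refine small_subset (s := Set.range F) ?_
  rintro y ⟨b, hb, rfl⟩
  refine ⟨⟨⟨b.1.1, b.1.2⟩, fun x => if hx : b.2 x ∈ T then ⟨b.2 x, hx⟩ else ⟨∅, hT⟩⟩, ?_⟩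
  apply collapse_congr
  filter_upwards [hb, h.seed_mem b.1.2, h.seed_mem a.1.2] with ω h1 h2 h3
  have h4 : b.2 (ω b.1.1) ∈ T := by
    refine ZFSet.mem_insert_iff.2 (Or.inr (ZFSet.mem_sUnion.2 ⟨a.2 (ω a.1.1), ?_, h1⟩))
    exact ZFSet.mem_range.2 ⟨⟨_, h3⟩, rfl⟩
  simp only [Term.val, dif_pos h2, dif_pos h4]

theorem mem_collapse (h : Nice E K U) {a : Term U} {y : ZFSet.{u}} :
    y ∈ h.collapse a ↔ ∃ b, h.rel b a ∧ y = h.collapse b := by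
  have := h.small_rel a
  rw [collapse_eq, mem_setOfClass]
  rfl

theorem not_rel_of (h : Nice E K U) {a b : Term U}
    (hab : ∀ᶠ ω in h.filter, a.val ω ∉ b.val ω) : ¬ h.rel a b := fun h' => by
  obtain ⟨ω, h1, h2⟩ := (hab.and h').exists
  exact h1 h2

theorem equal_of_collapse (h : Nice E K U) : ∀ a b : Term U, h.collapse a = h.collapse b →
    h.equal a b := by
  intro a
  induction a using h.rel_wf.induction with | _ a ih =>
  intro b hab
  refine (h.decide_term ![a, b] (fun x => x 0 = x 1)).resolve_right fun hne => ?_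
  obtain ⟨c, hc⟩ := h.choose_term ![a, b] (fun x y => ¬ (y ∈ x 0 ↔ y ∈ x 1)) (by
    filter_upwards [hne] with ω h1
    by_contra! h2
    exact h1 (ZFSet.ext h2))
  have h1 : ∀ᶠ ω in h.filter, ¬ (c.val ω ∈ a.val ω ↔ c.val ω ∈ b.val ω) := hc
  rcases h.decide_term ![c, a] (fun x => x 0 ∈ x 1) with h2 | h2
  · replace h2 : h.rel c a := h2
    have h3 : h.collapse c ∈ h.collapse b := by
      rw [← hab]
      exact h.mem_collapse.2 ⟨c, h2, rfl⟩
    obtain ⟨d, hd, e⟩ := h.mem_collapse.1 h3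
    have h4 := rel_congr_left (equal_symm (ih c h2 d e)) hd
    obtain ⟨ω, h5, h6, h7⟩ := (h1.and (h2.and h4)).exists
    exact h5 ⟨fun _ => h7, fun _ => h6⟩
  · replace h2 : ∀ᶠ ω in h.filter, c.val ω ∉ a.val ω := h2
    have h3 : h.collapse c ∈ h.collapse a := by
      rw [hab]
      refine h.mem_collapse.2 ⟨c, ?_, rfl⟩
      filter_upwards [h1, h2] with ω h4 h5
      tauto
    obtain ⟨d, hd, e⟩ := h.mem_collapse.1 h3
    exact h.not_rel_of h2 (rel_congr_left (ih d hd c e.symm) hd)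

theorem collapse_mem_iff (h : Nice E K U) {a b : Term U} :
    h.collapse a ∈ h.collapse b ↔ h.rel a b := by
  rw [h.mem_collapse]
  exact ⟨fun ⟨c, hc, e⟩ => rel_congr_left (equal_symm (h.equal_of_collapse _ _ e)) hc,
    fun hab => ⟨a, hab, rfl⟩⟩

/-- The transitive class of the ultrapower. -/
def target (h : Nice E K U) : Set ZFSet.{u} := Set.range h.collapse

theorem collapse_mem (h : Nice E K U) (a : Term U) : h.collapse a ∈ h.target := ⟨a, rfl⟩

theorem target_trans (h : Nice E K U) : TransClass h.target := by
  rintro _ ⟨a, rfl⟩ y hy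
  obtain ⟨b, _, rfl⟩ := h.mem_collapse.1 hy
  exact ⟨b, rfl⟩

theorem eventually_iff_of_decided {α : Type*} {f : Filter α} [f.NeBot] {P Q : α → Prop}
    (hP : (∀ᶠ x in f, P x) ∨ ∀ᶠ x in f, ¬ P x) :
    (∀ᶠ x in f, P x → Q x) ↔ ((∀ᶠ x in f, P x) → ∀ᶠ x in f, Q x) := by
  constructor
  · intro h h'
    filter_upwards [h, h'] with x h1 h2 using h1 h2
  · intro h
    rcases hP with h' | h'
    · exact (h h').mono fun _ h _ => h
    · exact h'.mono fun _ h1 h2 => absurd h2 h1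

theorem realize_iff (h : Nice E K U) {m l : ℕ} (φ : SetLang.BoundedFormula (Fin m) l)
    (a : Fin m → Term U) (b : Fin l → Term U) :
    φ.Realize (M := h.target) (fun i => ⟨h.collapse (a i), h.collapse_mem _⟩)
      (fun i => ⟨h.collapse (b i), h.collapse_mem _⟩) ↔
    ∀ᶠ ω in h.filter, φ.Realize (M := V.{u}) (fun i => ⟨(a i).val ω, trivial⟩)
      (fun i => ⟨(b i).val ω, trivial⟩) := by
  have term : ∀ {l : ℕ} (b : Fin l → Term U) (t : SetLang.Term (Fin m ⊕ Fin l)), ∃ c : Term U,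
      (t.realize (M := h.target) (Sum.elim (fun i => ⟨h.collapse (a i), h.collapse_mem _⟩)
        (fun i => ⟨h.collapse (b i), h.collapse_mem _⟩)) : ZFSet) = h.collapse c ∧
      ∀ ω, (t.realize (M := V.{u}) (Sum.elim (fun i => ⟨(a i).val ω, trivial⟩)
        (fun i => ⟨(b i).val ω, trivial⟩)) : ZFSet) = c.val ω := by
    intro l b t
    cases t with
    | var i =>
      rcases i with i | i
      · exact ⟨a i, rfl, fun _ => rfl⟩
      · exact ⟨b i, rfl, fun _ => rfl⟩
    | func f _ => exact f.elim
  induction φ with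
  | falsum =>
    simp only [Language.BoundedFormula.Realize, eventually_const]
  | equal t s =>
    obtain ⟨c, hc, hc'⟩ := term b t
    obtain ⟨d, hd, hd'⟩ := term b s
    simp only [Language.BoundedFormula.Realize, ← Subtype.coe_inj, hc, hd, hc', hd']
    exact ⟨h.equal_of_collapse _ _, collapse_congr⟩
  | rel r ts =>
    cases r with
    | mem =>
      obtain ⟨c, hc, hc'⟩ := term b (ts 0)
      obtain ⟨d, hd, hd'⟩ := term b (ts 1)
      refine Iff.trans (b := h.collapse c ∈ h.collapse d) ?_ (h.collapse_mem_iff.trans ?_)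
      · rw [← hc, ← hd]
        rfl
      · refine eventually_congr (Eventually.of_forall fun ω => ?_)
        rw [← hc', ← hd']
        rfl
  | imp φ ψ ih1 ih2 =>
    simp only [Language.BoundedFormula.realize_imp]
    refine (imp_congr (ih1 b) (ih2 b)).trans (eventually_iff_of_decided ?_).symm
    have := h.decide_term (Fin.append a b) (fun x => φ.Realize (M := V.{u})
      (fun i => ⟨x (Fin.castAdd _ i), trivial⟩) (fun i => ⟨x (Fin.natAdd _ i), trivial⟩))
    simpa only [Fin.append_left, Fin.append_right] using this
  | @all l φ ih =>
    simp only [Language.BoundedFormula.realize_all]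
    have e1 : ∀ c : Term U, (Fin.snoc (α := fun _ => h.target)
        (fun i => ⟨h.collapse (b i), h.collapse_mem _⟩)
        ⟨h.collapse c, h.collapse_mem _⟩ : Fin (l + 1) → h.target) =
        fun i => ⟨h.collapse ((Fin.snoc b c : Fin (l + 1) → Term U) i), h.collapse_mem _⟩ := by
      intro c
      funext i
      refine Fin.lastCases ?_ (fun i => ?_) i <;> simp
    have e2 : ∀ (ω) (c : Term U), (Fin.snoc (α := fun _ => V.{u})
        (fun i => ⟨(b i).val ω, trivial⟩)
        ⟨c.val ω, trivial⟩ : Fin (l + 1) → V.{u}) =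
        fun i => ⟨((Fin.snoc b c : Fin (l + 1) → Term U) i).val ω, trivial⟩ := by
      intro ω c
      funext i
      refine Fin.lastCases ?_ (fun i => ?_) i <;> simp
    constructor
    · intro hall
      by_contra hne
      have hd := h.decide_term (Fin.append a b) (fun x => ∀ y : V.{u}, φ.Realize (M := V.{u})
        (fun i => ⟨x (Fin.castAdd _ i), trivial⟩)
        (Fin.snoc (fun i => ⟨x (Fin.natAdd _ i), trivial⟩) y))
      simp only [Fin.append_left, Fin.append_right] at hd
      have hd := hd.resolve_left hne
      obtain ⟨c, hc⟩ := h.choose_term (Fin.append a b) (fun x y => ¬ φ.Realize (M := V.{u})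
        (fun i => ⟨x (Fin.castAdd _ i), trivial⟩)
        (Fin.snoc (fun i => ⟨x (Fin.natAdd _ i), trivial⟩) ⟨y, trivial⟩)) (by
          filter_upwards [hd] with ω h1
          simp only [Fin.append_left, Fin.append_right]
          by_contra! h2
          exact h1 fun y => h2 y.1)
      simp only [Fin.append_left, Fin.append_right, e2] at hc
      have := hall ⟨h.collapse c, h.collapse_mem _⟩
      rw [e1] at this
      obtain ⟨ω, h1, h2⟩ := (hc.and ((ih _).1 this)).exists
      exact h1 h2
    · rintro hall ⟨_, c, rfl⟩
      have := (ih (Fin.snoc b c)).2 (by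
        filter_upwards [hall] with ω h1
        rw [← e2]
        exact h1 _)
      rwa [← e1] at this

/-- The term for a constant function. -/
def const (h : Nice E K U) (x : ZFSet.{u}) : Term U := ⟨⟨∅, h.sub h.empty⟩, fun _ => x⟩

/-- The elementary embedding of the universe into the ultrapower. -/
noncomputable def emb (h : Nice E K U) : ClassEmb V.{u} h.target where
  j x := h.collapse (h.const x)
  maps x _ := h.collapse_mem _
  elem {n} φ v hv := by
    refine Iff.trans ?_ (Iff.trans (h.realize_iff (m := n) (l := 0) φ (fun i => h.const (v i))
      Fin.elim0).symm ?_)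
    · have e : φ.Realize (M := V.{u}) (fun i => ⟨v i, hv i⟩) ↔
          Language.BoundedFormula.Realize (M := V.{u}) φ (fun i => ⟨v i, trivial⟩)
            (fun i : Fin 0 => ⟨Term.val (U := U) id (Fin.elim0 i), trivial⟩) := by
        refine iff_of_eq ?_
        unfold Language.Formula.Realize
        congr 1
        exact Subsingleton.elim _ _
      refine e.trans ((eventually_const (f := h.filter)).symm.trans
        (eventually_congr (Eventually.of_forall fun ω => iff_of_eq ?_)))
      congr 1
      exact Subsingleton.elim _ _
    · refine iff_of_eq ?_
      unfold Language.Formula.Realize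
      congr 1
      exact Subsingleton.elim _ _

theorem collapse_seed (h : Nice E K U) : ∀ (u : ZFSet.{u}) (hu : u ∈ U),
    h.collapse ⟨⟨u, hu⟩, id⟩ = u := by
  intro u
  induction u using ZFSet.inductionOn with | _ u ih =>
  intro hu
  ext y
  rw [h.mem_collapse]
  constructor
  · rintro ⟨b, hb, rfl⟩
    let R : ZFSet.{u} := ZFSet.sep (fun p => ∃ x z, p = ZFSet.pair x z ∧ b.2 x = z) K
    let Y : ZFSet.{u} := ZFSet.sep (fun p => ∃ x ∈ K, ∃ y ∈ K, ∃ z ∈ K,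
      p = ZFSet.pair x y ∧ z ∈ y ∧ ZFSet.pair x z ∈ R) K
    have hbu : ZFSet.pair b.1.1 u ∈ U := h.pairU _ b.1.2 _ hu
    have hY : ZFSet.pair (ZFSet.pair b.1.1 u) Y ∈ E := by
      refine h.mem_of_eventually hbu (fun x hx => (ZFSet.mem_sep.1 hx).1) ?_
      filter_upwards [hb, h.seed_mem hu, h.seed_mem b.1.2, h.seed_pair b.1.2 hu] with ω h1 h2 h3 h4
      have h5 : b.2 (ω b.1.1) ∈ K := h.transK.mem_trans h1 h2
      rw [h4]
      exact ZFSet.mem_sep.2 ⟨h.pairK _ h3 _ h2, _, h3, _, h2, _, h5, rfl, h1,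
        ZFSet.mem_sep.2 ⟨h.pairK _ h3 _ h5, _, _, rfl, rfl⟩⟩
    obtain ⟨v, hv, hR⟩ := h.ext.normal R Y (fun x hx => (ZFSet.mem_sep.1 hx).1)
      (fun x hx => (ZFSet.mem_sep.1 hx).1) (fun p hp => (ZFSet.mem_sep.1 hp).2) _ b.1.2 _ hu hY
    have hvU : v ∈ U := h.transU.mem_trans hv hu
    rw [← ih v hv hvU] at hv
    convert hv using 1
    apply collapse_congr
    filter_upwards [h.mem_seed hR, h.seed_pair b.1.2 hvU] with ω h1 h2
    rw [h2] at h1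
    obtain ⟨_, x, z, e, rfl⟩ := ZFSet.mem_sep.1 h1
    obtain ⟨rfl, e2⟩ := ZFSet.pair_inj.1 e
    exact e2.symm
  · intro hy
    have hyU : y ∈ U := h.transU.mem_trans hy hu
    exact ⟨⟨⟨y, hyU⟩, id⟩, h.seed_lt hu hy, (ih y hy hyU).symm⟩

theorem emb_fix (h : Nice E K U) {x : ZFSet.{u}} (hx : x ∈ K) : h.emb.j x = x := by
  conv_rhs => rw [← h.collapse_seed x (h.sub hx)]
  exact collapse_congr ((h.seed_fix hx).mono fun ω hω => hω.symm)

theorem sub_target (h : Nice E K U) {u : ZFSet.{u}} (hu : u ∈ U) : u ∈ h.target :=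
  ⟨_, h.collapse_seed u hu⟩

theorem mem_emb (h : Nice E K U) {u X : ZFSet.{u}} (hu : u ∈ U) (hX : ZFSet.pair u X ∈ E) :
    u ∈ h.emb.j X := by
  have := (h.collapse_mem_iff (a := ⟨⟨u, hu⟩, id⟩) (b := h.const X)).2 (h.mem_seed hX)
  rwa [h.collapse_seed] at this

end Extender.Nice

/-- An extender induces an elementary embedding of the universe into a transitive class. -/
theorem Extender.Nice.exists_emb {E K U : ZFSet.{u}} (h : Extender.Nice E K U) :
    ∃ (M : Set ZFSet.{u}) (e : ClassEmb V.{u} M), TransClass M ∧ (∀ x ∈ K, e.j x = x) ∧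
      (∀ u ∈ U, u ∈ M) ∧ (∀ u ∈ U, ∀ X, ZFSet.pair u X ∈ E → u ∈ e.j X) :=
  ⟨h.target, h.emb, h.target_trans, fun _ => h.emb_fix, fun _ => h.sub_target,
    fun _ hu _ => h.mem_emb hu⟩

/-! ### Coding sequences by sets -/

/-- A standard name for the natural number `n`. -/
noncomputable def num (n : ℕ) : ZFSet.{u} := ZFSet.vonNeumann n

theorem num_inj {m n : ℕ} : num.{u} m = num n ↔ m = n := by
  rw [num, num, ZFSet.vonNeumann_inj, Nat.cast_inj]

/-- The set of all names for natural numbers. -/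
noncomputable def nums : ZFSet.{u} := ZFSet.range (fun n : ULift.{u} ℕ => num n.down)

theorem mem_nums {x : ZFSet.{u}} : x ∈ nums ↔ ∃ n, x = num n := by
  rw [nums, ZFSet.mem_range]
  exact ⟨fun ⟨n, h⟩ => ⟨n.down, h.symm⟩, fun ⟨n, h⟩ => ⟨⟨n⟩, h.symm⟩⟩

theorem num_mem (n : ℕ) : num.{u} n ∈ nums := mem_nums.2 ⟨n, rfl⟩

/-- The set coding a sequence. -/
noncomputable def seq (f : ℕ → ZFSet.{u}) : ZFSet.{u} :=
  ZFSet.range (fun n : ULift.{u} ℕ => ZFSet.pair (num n.down) (f n.down))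

theorem mem_seq {f : ℕ → ZFSet.{u}} {p : ZFSet.{u}} :
    p ∈ seq f ↔ ∃ n, p = ZFSet.pair (num n) (f n) := by
  rw [seq, ZFSet.mem_range]
  exact ⟨fun ⟨n, h⟩ => ⟨n.down, h.symm⟩, fun ⟨n, h⟩ => ⟨⟨n⟩, h.symm⟩⟩

theorem pair_mem_seq {f : ℕ → ZFSet.{u}} {n : ℕ} {y : ZFSet.{u}} :
    ZFSet.pair (num n) y ∈ seq f ↔ y = f n := by
  rw [mem_seq]
  constructor
  · rintro ⟨m, h⟩
    obtain ⟨h1, h2⟩ := ZFSet.pair_inj.1 h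
    rw [num_inj.1 h1, h2]
  · rintro rfl
    exact ⟨n, rfl⟩

theorem LaverDiamond.TransClass.of_pair {M : Set ZFSet.{u}} (hM : TransClass M) {a b : ZFSet.{u}}
    (h : ZFSet.pair a b ∈ M) : a ∈ M ∧ b ∈ M := by
  have h1 : ({a, b} : ZFSet) ∈ M := hM _ h _ (by simp [ZFSet.pair])
  exact ⟨hM _ h1 _ (by simp), hM _ h1 _ (by simp)⟩

theorem LaverDiamond.TransClass.seq_val {M : Set ZFSet.{u}} (hM : TransClass M) {f : ℕ → ZFSet.{u}}
    (h : seq f ∈ M) (n : ℕ) : f n ∈ M :=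
  (hM.of_pair (hM _ h _ (pair_mem_seq.2 rfl : ZFSet.pair (num n) (f n) ∈ seq f))).2

/-- `f` is a function from `w` to `S`. -/
def SeqIn (w S f : ZFSet.{u}) : Prop :=
  (∀ p ∈ f, ∃ n ∈ w, ∃ y ∈ S, p = ZFSet.pair n y) ∧
    ∀ n ∈ w, ∃ y ∈ S, ZFSet.pair n y ∈ f ∧ ∀ z ∈ S, ZFSet.pair n z ∈ f → z = y

theorem Dfn.seqIn {n : ℕ} (w s f : Fin n) : Dfn.{u} (fun _ v => SeqIn (v w) (v s) (v f)) := by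
  unfold SeqIn
  apply_rules [and, or, imp, bex, ball, mem, eq, eq_pair, pair_mem]

theorem seqIn_iff {S f : ZFSet.{u}} :
    SeqIn nums S f ↔ ∃ g : ℕ → ZFSet.{u}, (∀ n, g n ∈ S) ∧ f = seq g := by
  constructor
  · rintro ⟨h1, h2⟩
    choose g hg hg' hg'' using fun n : ℕ => h2 (num n) (num_mem n)
    refine ⟨g, hg, ?_⟩
    ext p
    rw [mem_seq]
    constructor
    · intro hp
      obtain ⟨_, hm, y, hy, rfl⟩ := h1 p hp
      obtain ⟨n, rfl⟩ := mem_nums.1 hm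
      exact ⟨n, by rw [hg'' n y hy hp]⟩
    · rintro ⟨n, rfl⟩
      exact hg' n
  · rintro ⟨g, hg, rfl⟩
    refine ⟨fun p hp => ?_, fun m hm => ?_⟩
    · obtain ⟨n, rfl⟩ := mem_seq.1 hp
      exact ⟨_, num_mem n, _, hg n, rfl⟩
    · obtain ⟨n, rfl⟩ := mem_nums.1 hm
      exact ⟨g n, hg n, pair_mem_seq.2 rfl, fun z _ hz => pair_mem_seq.1 hz⟩

/-- `U` is closed under pairs and under `w`-sequences lying in `M`. -/
def ClosedIn (M : Set ZFSet.{u}) (w U : ZFSet.{u}) : Prop :=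
  (∀ x ∈ U, ∀ y ∈ U, ∃ p ∈ U, p = ZFSet.pair x y) ∧ ∀ s ∈ M, SeqIn w U s → s ∈ U

theorem Dfn.closedIn {n : ℕ} (w U : Fin n) : Dfn.{u} (fun M v => ClosedIn M (v w) (v U)) := by
  unfold ClosedIn
  apply_rules [and, or, imp, bex, ball, all, mem, eq, eq_pair, pair_mem, seqIn]

theorem ClosedIn.pairClosed {M : Set ZFSet.{u}} {w U : ZFSet.{u}} (h : ClosedIn M w U) :
    PairClosed U := fun x hx y hy => by
  obtain ⟨p, hp, rfl⟩ := h.1 x hx y hy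
  exact hp

theorem ClosedIn.seq_mem {M : Set ZFSet.{u}} {U : ZFSet.{u}} (h : ClosedIn M nums U)
    {f : ℕ → ZFSet.{u}} (hM : seq f ∈ M) (hf : ∀ n, f n ∈ U) : seq f ∈ U :=
  h.2 _ hM (seqIn_iff.2 ⟨f, hf, rfl⟩)

theorem ClosedIn.mono {M N : Set ZFSet.{u}} {w U : ZFSet.{u}} (h : ClosedIn M w U) (hN : N ⊆ M) :
    ClosedIn N w U := ⟨h.1, fun s hs => h.2 s (hN hs)⟩

/-! ### Extenders inside a transitive class -/

/-- There is in `M` a valuation for the sequence of measure one sets `s`. -/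
def StarIn (M : Set ZFSet.{u}) (w K s : ZFSet.{u}) : Prop :=
  ∃ h ∈ M, SeqIn w K h ∧ ∀ m ∈ w, ∀ n ∈ w, ∀ l ∈ w, ∀ p ∈ M, ∀ q ∈ M, ∀ r ∈ M,
    ZFSet.pair m p ∈ s → ZFSet.pair n q ∈ s → ZFSet.pair l r ∈ s →
    ∀ a ∈ M, ∀ b ∈ M, ∀ c ∈ M, ∀ A ∈ M, ∀ B ∈ M, ∀ C ∈ M,
    p = ZFSet.pair a A → q = ZFSet.pair b B → r = ZFSet.pair c C →
    ∀ x ∈ K, ∀ y ∈ K, ∀ z ∈ K, ZFSet.pair m x ∈ h → ZFSet.pair n y ∈ h → ZFSet.pair l z ∈ h →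
    x ∈ A ∧ (a = b → x = y) ∧ (a = ZFSet.pair b c → x = ZFSet.pair y z) ∧
      (a ∈ b → x ∈ y) ∧ (a ∈ K → x = a)

theorem Dfn.starIn {n : ℕ} (w K s : Fin n) :
    Dfn.{u} (fun M v => StarIn M (v w) (v K) (v s)) := by
  unfold StarIn
  repeat' first
    | exact mem _ _ | exact eq _ _ | exact eq_pair _ _ _ | exact pair_mem _ _ _ | exact seqIn _ _ _
    | apply all | apply ex | apply ball | apply imp | apply and

theorem starIn_iff {M : Set ZFSet.{u}} (hM : TransClass M) {K : ZFSet.{u}}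
    {u X : ℕ → ZFSet.{u}} (hs : seq (fun n => ZFSet.pair (u n) (X n)) ∈ M) :
    StarIn M nums K (seq fun n => ZFSet.pair (u n) (X n)) ↔
    ∃ x : ℕ → ZFSet.{u}, seq x ∈ M ∧ (∀ n, x n ∈ K) ∧ (∀ n, x n ∈ X n) ∧
      (∀ m n, u m = u n → x m = x n) ∧
      (∀ m n l, u m = ZFSet.pair (u n) (u l) → x m = ZFSet.pair (x n) (x l)) ∧
      (∀ m n, u m ∈ u n → x m ∈ x n) ∧ ∀ n, u n ∈ K → x n = u n := by
  constructor
  · rintro ⟨h, hhM, hh, h1⟩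
    obtain ⟨x, hx, rfl⟩ := seqIn_iff.1 hh
    have key := fun m n l => h1 (num m) (num_mem m) (num n) (num_mem n) (num l) (num_mem l)
      _ (hM.seq_val hs m) _ (hM.seq_val hs n) _ (hM.seq_val hs l)
      (pair_mem_seq.2 rfl) (pair_mem_seq.2 rfl) (pair_mem_seq.2 rfl)
      _ (hM.of_pair (hM.seq_val hs m)).1 _ (hM.of_pair (hM.seq_val hs n)).1
      _ (hM.of_pair (hM.seq_val hs l)).1 _ (hM.of_pair (hM.seq_val hs m)).2
      _ (hM.of_pair (hM.seq_val hs n)).2 _ (hM.of_pair (hM.seq_val hs l)).2 rfl rfl rfl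
      (x m) (hx m) (x n) (hx n) (x l) (hx l)
      (pair_mem_seq.2 rfl) (pair_mem_seq.2 rfl) (pair_mem_seq.2 rfl)
    exact ⟨x, hhM, hx, fun n => (key n n n).1, fun m n => (key m n n).2.1,
      fun m n l => (key m n l).2.2.1, fun m n => (key m n n).2.2.2.1,
      fun n => (key n n n).2.2.2.2⟩
  · rintro ⟨x, hxM, hx, h1, h2, h3, h4, h5⟩
    refine ⟨seq x, hxM, seqIn_iff.2 ⟨x, hx, rfl⟩, ?_⟩
    intro m hm n hn l hl p _ q _ r _ hp hq hr a _ b _ c _ A _ B _ C _ ep eq er x' _ y' _ z' _ ex ey ez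
    obtain ⟨m, rfl⟩ := mem_nums.1 hm
    obtain ⟨n, rfl⟩ := mem_nums.1 hn
    obtain ⟨l, rfl⟩ := mem_nums.1 hl
    rw [pair_mem_seq] at hp hq hr ex ey ez
    obtain ⟨rfl, rfl⟩ := ZFSet.pair_inj.1 (ep.symm.trans hp)
    obtain ⟨rfl, rfl⟩ := ZFSet.pair_inj.1 (eq.symm.trans hq)
    obtain ⟨rfl, rfl⟩ := ZFSet.pair_inj.1 (er.symm.trans hr)
    subst ex ey ez
    exact ⟨h1 m, h2 m n, h3 m n l, h4 m n, h5 m⟩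

/-- `E` is an extender in the sense of the class `M`. -/
def ExtenderIn (M : Set ZFSet.{u}) (w E K U : ZFSet.{u}) : Prop :=
  (∀ p ∈ E, ∃ u ∈ U, ∃ X ∈ M, X ⊆ K ∧ p = ZFSet.pair u X) ∧
  (∀ u ∈ U, ∀ X ∈ M, ∀ X' ∈ M, X ⊆ K → X' ⊆ K → (∀ x ∈ K, x ∈ X ∨ x ∈ X') →
    ZFSet.pair u X ∈ E ∨ ZFSet.pair u X' ∈ E) ∧
  (∀ s ∈ M, SeqIn w E s → StarIn M w K s) ∧
  ∀ R ∈ M, ∀ Y ∈ M, R ⊆ K → Y ⊆ K →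
    (∀ p ∈ Y, ∃ x ∈ K, ∃ y ∈ K, ∃ z ∈ K, p = ZFSet.pair x y ∧ z ∈ y ∧ ZFSet.pair x z ∈ R) →
    ∀ a ∈ U, ∀ u ∈ U, ZFSet.pair (ZFSet.pair a u) Y ∈ E → ∃ v ∈ u, ZFSet.pair (ZFSet.pair a v) R ∈ E

theorem Dfn.extenderIn {n : ℕ} (w E K U : Fin n) :
    Dfn.{u} (fun M v => ExtenderIn M (v w) (v E) (v K) (v U)) := by
  unfold ExtenderIn
  repeat' first
    | exact mem _ _ | exact eq _ _ | exact eq_pair _ _ _ | exact pair_mem _ _ _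
    | exact pair_pair_mem _ _ _ _ | exact subset _ _ | exact seqIn _ _ _ | exact starIn _ _ _
    | apply all | apply ex | apply ball | apply bex | apply imp | apply and | apply or

theorem extenderIn_iff {M : Set ZFSet.{u}} (hM : TransClass M) {E K U : ZFSet.{u}}
    (hK : ∀ X, X ⊆ K → X ∈ M) (hE : ∀ f : ℕ → ZFSet.{u}, (∀ n, f n ∈ E) → seq f ∈ M)
    (hK' : ∀ f : ℕ → ZFSet.{u}, (∀ n, f n ∈ K) → seq f ∈ M) :
    ExtenderIn M nums E K U ↔ Extender E K U := by
  constructor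
  · rintro ⟨h1, h2, h3, h4⟩
    refine ⟨fun p hp => ?_, fun u hu X X' hX hX' => h2 u hu X (hK X hX) X' (hK _ hX') hX hX', ?_,
      fun R Y hR hY => h4 R (hK _ hR) Y (hK _ hY) hR hY⟩
    · obtain ⟨u, hu, X, _, hX⟩ := h1 p hp
      exact ⟨u, hu, X, hX⟩
    · intro u X huX
      obtain ⟨x, -, hx⟩ := (starIn_iff hM (hE _ huX)).1 (h3 _ (hE _ huX) (seqIn_iff.2 ⟨_, huX, rfl⟩))
      exact ⟨x, hx⟩
  · rintro ⟨h1, h2, h3, h4⟩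
    refine ⟨fun p hp => ?_, fun u hu X _ X' _ => h2 u hu X X', ?_,
      fun R _ Y _ => h4 R Y⟩
    · obtain ⟨u, hu, X, hX, h⟩ := h1 p hp
      exact ⟨u, hu, X, hK X hX, hX, h⟩
    · intro s hs hsE
      obtain ⟨g, hg, rfl⟩ := seqIn_iff.1 hsE
      choose u hu X hX huX using fun n => h1 (g n) (hg n)
      obtain rfl : g = fun n => ZFSet.pair (u n) (X n) := funext huX
      obtain ⟨x, hx, h⟩ := h3 u X hg
      exact (starIn_iff hM hs).2 ⟨x, hK' x hx, hx, h⟩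

theorem transClass_univ : TransClass (Set.univ : Set ZFSet.{u}) := fun _ _ _ _ => trivial

theorem extenderIn_univ {E K U : ZFSet.{u}} :
    ExtenderIn Set.univ nums E K U ↔ Extender E K U :=
  extenderIn_iff transClass_univ (fun _ _ => trivial) (fun _ _ => trivial) (fun _ _ => trivial)

namespace LaverDiamond.ClassEmb

variable {M : Set ZFSet.{u}} (e : ClassEmb V.{u} M)

theorem j_mem_class (x : ZFSet.{u}) : e.j x ∈ M := e.maps x trivial

theorem mem_iff (hM : TransClass M) {x y : ZFSet.{u}} : e.j x ∈ e.j y ↔ x ∈ y :=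
  (e.transfer hM (Dfn.mem 0 1) ![x, y]).symm

theorem inj_iff (hM : TransClass M) {x y : ZFSet.{u}} : e.j x = e.j y ↔ x = y :=
  (e.transfer hM (Dfn.eq 0 1) ![x, y]).symm

theorem subset_iff (hM : TransClass M) {x y : ZFSet.{u}} : e.j x ⊆ e.j y ↔ x ⊆ y :=
  (e.transfer hM (Dfn.subset 0 1) ![x, y]).symm

theorem j_pair (hM : TransClass M) (a b : ZFSet.{u}) :
    e.j (ZFSet.pair a b) = ZFSet.pair (e.j a) (e.j b) :=
  (e.transfer hM (Dfn.eq_pair 0 1 2) ![ZFSet.pair a b, a, b]).1 rfl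

theorem j_trans (hM : TransClass M) {x : ZFSet.{u}} (hx : x.IsTransitive) :
    (e.j x).IsTransitive := by
  have h : Dfn.{u} (fun M (v : Fin 1 → ZFSet.{u}) => ∀ y ∈ v 0, ∀ z ∈ y, z ∈ v 0) := by
    apply_rules [Dfn.ball, Dfn.mem]
  have := (e.transfer hM h ![x]).1 (fun y hy z hz => hx.mem_trans hz hy)
  exact fun y hy z hz => this y hy z hz

/-- The embedding fixes the natural numbers. -/
structure FixNums : Prop where
  j_nums : e.j nums = nums
  j_num (n : ℕ) : e.j (num n) = num n

variable {e}

theorem FixNums.j_seq (hw : e.FixNums) (hM : TransClass M) (f : ℕ → ZFSet.{u}) :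
    e.j (seq f) = seq (fun n => e.j (f n)) := by
  have h := (e.transfer hM (Dfn.seqIn 0 1 2)
    ![nums, ZFSet.range (fun n : ULift.{u} ℕ => f n.down), seq f]).1
    (seqIn_iff.2 ⟨f, fun n => ZFSet.mem_range.2 ⟨⟨n⟩, rfl⟩, rfl⟩)
  simp only [Matrix.cons_val] at h
  rw [hw.j_nums, seqIn_iff] at h
  obtain ⟨g, -, hg⟩ := h
  rw [hg]
  congr 1
  funext n
  have h1 := (e.mem_iff hM).2 (pair_mem_seq.2 rfl : ZFSet.pair (num n) (f n) ∈ seq f)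
  rw [e.j_pair hM, hw.j_num, hg, pair_mem_seq] at h1
  exact h1.symm

/-- The extender derived from an elementary embedding. -/
theorem exists_extender (hM : TransClass M) (hw : e.FixNums) {K U : ZFSet.{u}}
    (hfix : ∀ x ∈ K, e.j x = x) (hU : U.IsTransitive) (hUp : PairClosed U) (hUK : U ⊆ e.j K)
    (hseq : ∀ f : ℕ → ZFSet.{u}, (∀ n, f n ∈ U) → seq f ∈ M) :
    ∃ E, (∀ u X, ZFSet.pair u X ∈ E ↔ u ∈ U ∧ X ⊆ K ∧ u ∈ e.j X) ∧ Extender E K U := by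
  classical
  let E : ZFSet.{u} := ZFSet.sep (fun p => ∃ u X, u ∈ e.j X ∧ p = ZFSet.pair u X)
    (ZFSet.prod U (ZFSet.powerset K))
  have hE : ∀ u X, ZFSet.pair u X ∈ E ↔ u ∈ U ∧ X ⊆ K ∧ u ∈ e.j X := by
    intro u X
    simp only [E, ZFSet.mem_sep, ZFSet.pair_mem_prod, ZFSet.mem_powerset]
    constructor
    · rintro ⟨⟨h1, h2⟩, u', X', h3, h⟩
      obtain ⟨rfl, rfl⟩ := ZFSet.pair_inj.1 h
      exact ⟨h1, h2, h3⟩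
    · rintro ⟨h1, h2, h3⟩
      exact ⟨⟨h1, h2⟩, u, X, h3, rfl⟩
  refine ⟨E, hE, ?_, ?_, ?_, ?_⟩
  · intro p hp
    obtain ⟨_, u, X, _, rfl⟩ := ZFSet.mem_sep.1 hp
    have := (hE u X).1 hp
    exact ⟨u, this.1, X, this.2.1, rfl⟩
  · intro u hu X X' hX hX' h
    have hd : Dfn.{u} (fun M (v : Fin 3 → ZFSet.{u}) => ∀ x ∈ v 0, x ∈ v 1 ∨ x ∈ v 2) := by
      apply_rules [Dfn.ball, Dfn.mem, Dfn.or]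
    exact ((e.transfer hM hd ![K, X, X']).1 h u (hUK hu)).imp
      (fun h => (hE _ _).2 ⟨hu, hX, h⟩) (fun h => (hE _ _).2 ⟨hu, hX', h⟩)
  · intro u X h
    have hu : ∀ n, u n ∈ U := fun n => ((hE _ _).1 (h n)).1
    have huX : ∀ n, u n ∈ e.j (X n) := fun n => ((hE _ _).1 (h n)).2.2
    have ht := e.transfer hM (Dfn.starIn 0 1 2) ![nums, K, seq fun n => ZFSet.pair (u n) (X n)]
    simp only [Matrix.cons_val] at ht
    rw [hw.j_nums] at ht
    have hj : e.j (seq fun n => ZFSet.pair (u n) (X n)) =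
        seq fun n => ZFSet.pair (e.j (u n)) (e.j (X n)) := by
      rw [hw.j_seq hM]
      simp only [e.j_pair hM]
    rw [hj, starIn_iff transClass_univ trivial, starIn_iff hM (hj ▸ e.j_mem_class _)] at ht
    obtain ⟨x, -, hx⟩ := ht.2 ⟨u, hseq u hu, fun n => hUK (hu n), huX,
      fun m n => (e.inj_iff hM).1,
      fun m n l h => by rwa [← e.j_pair hM, e.inj_iff hM] at h,
      fun m n => (e.mem_iff hM).1,
      fun n h => ((hfix _ ((e.mem_iff hM).1 h))).symm⟩
    exact ⟨x, hx⟩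
  · intro R Y hR hY h a ha u hu haY
    have hd : Dfn.{u} (fun M (v : Fin 3 → ZFSet.{u}) => ∀ p ∈ v 0, ∃ x ∈ v 1, ∃ y ∈ v 1, ∃ z ∈ v 1,
        p = ZFSet.pair x y ∧ z ∈ y ∧ ZFSet.pair x z ∈ v 2) := by
      apply_rules [Dfn.ball, Dfn.bex, Dfn.mem, Dfn.and, Dfn.eq_pair, Dfn.pair_mem]
    obtain ⟨x, -, y, -, z, -, h1, h2, h3⟩ :=
      (e.transfer hM hd ![Y, K, R]).1 h _ ((hE _ _).1 haY).2.2
    obtain ⟨rfl, rfl⟩ := ZFSet.pair_inj.1 h1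
    exact ⟨z, h2, (hE _ _).2 ⟨hUp _ ha _ (hU.mem_trans h2 hu), hR, h3⟩⟩

end LaverDiamond.ClassEmb

open ZFSet (vonNeumann)

/-- The set of all levels of the cumulative hierarchy below `o`. -/
noncomputable def levels (o : Ordinal.{u}) : ZFSet.{u} :=
  ZFSet.sep (fun x => ∃ a, x = vonNeumann a) (vonNeumann o)

theorem mem_levels {o : Ordinal.{u}} {x : ZFSet.{u}} : x ∈ levels o ↔ ∃ a < o, x = vonNeumann a := by
  rw [levels, ZFSet.mem_sep]
  constructor
  · rintro ⟨h, a, rfl⟩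
    exact ⟨a, ZFSet.vonNeumann_mem_vonNeumann_iff.1 h, rfl⟩
  · rintro ⟨a, h, rfl⟩
    exact ⟨ZFSet.vonNeumann_mem_vonNeumann_iff.2 h, a, rfl⟩

theorem vonNeumann_mem_levels {a o : Ordinal.{u}} : vonNeumann a ∈ levels o ↔ a < o := by
  rw [mem_levels]
  exact ⟨fun ⟨b, h, e⟩ => ZFSet.vonNeumann_inj.1 e ▸ h, fun h => ⟨a, h, rfl⟩⟩

namespace LaverDiamond.ClassEmb

variable {M : Set ZFSet.{u}} (e : ClassEmb V.{u} M)

theorem rank_le (hM : TransClass M) (x : ZFSet.{u}) : x.rank ≤ (e.j x).rank := by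
  induction x using ZFSet.inductionOn with
  | _ x ih =>
    rw [ZFSet.rank_le_iff]
    exact fun y hy => (ih y hy).trans_lt (ZFSet.rank_lt_of_mem ((e.mem_iff hM).2 hy))

theorem mem_j_level (hM : TransClass M) {o : Ordinal.{u}} : ∀ v ∈ e.j (levels o), ∀ z ∈ M,
    z ∈ v ↔ z.rank < v.rank := by
  have hd : Dfn.{u} (fun M (v : Fin 1 → ZFSet.{u}) => ∀ z ∈ M, ∀ x ∈ v 0,
      (z ∈ x ↔ ∃ w ∈ v 0, w ∈ x ∧ z ⊆ w)) := by
    apply_rules [Dfn.all, Dfn.ball, Dfn.iff, Dfn.bex, Dfn.and, Dfn.mem, Dfn.subset]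
  have hV : ∀ z ∈ Set.univ, ∀ x ∈ levels o, (z ∈ x ↔ ∃ w ∈ levels o, w ∈ x ∧ z ⊆ w) := by
    intro z _ x hx
    obtain ⟨a, ha, rfl⟩ := mem_levels.1 hx
    rw [ZFSet.mem_vonNeumann']
    constructor
    · rintro ⟨b, hb, h⟩
      exact ⟨_, vonNeumann_mem_levels.2 (hb.trans ha), ZFSet.vonNeumann_mem_vonNeumann_iff.2 hb, h⟩
    · rintro ⟨w, hw, hwx, h⟩
      obtain ⟨b, hb, rfl⟩ := mem_levels.1 hw
      exact ⟨b, ZFSet.vonNeumann_mem_vonNeumann_iff.1 hwx, h⟩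
  have key := (e.transfer hM hd ![levels o]).1 hV
  simp only [Matrix.cons_val] at key
  intro v
  induction v using ZFSet.inductionOn with
  | _ v ih =>
    intro hv z hz
    refine ⟨ZFSet.rank_lt_of_mem, fun h => ?_⟩
    obtain ⟨y, hy, hzy⟩ := ZFSet.lt_rank_iff.1 h
    have hyM : y ∈ M := hM _ (hM _ (e.j_mem_class _) _ hv) _ hy
    obtain ⟨w, hw, hwv, hyw⟩ := (key y hyM v hv).1 hy
    refine (key z hz v hv).2 ⟨w, hw, hwv, fun x hx => ?_⟩
    exact (ih w hwv hw x (hM _ hz _ hx)).2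
      ((ZFSet.rank_lt_of_mem hx).trans_le (hzy.trans (ZFSet.rank_mono hyw)))

theorem mem_j_vonNeumann_iff (hM : TransClass M) {o : Ordinal.{u}} {z : ZFSet.{u}} (hz : z ∈ M) :
    z ∈ e.j (vonNeumann o) ↔ ∃ w ∈ e.j (levels o), z ⊆ w := by
  have hd : Dfn.{u} (fun M (v : Fin 2 → ZFSet.{u}) => ∀ z ∈ M,
      (z ∈ v 0 ↔ ∃ w ∈ v 1, z ⊆ w)) := by
    apply_rules [Dfn.all, Dfn.ball, Dfn.iff, Dfn.bex, Dfn.and, Dfn.mem, Dfn.subset]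
  refine (e.transfer hM hd ![vonNeumann o, levels o]).1 (fun z _ => ?_) z hz
  simp only [Matrix.cons_val]
  rw [ZFSet.mem_vonNeumann']
  constructor
  · rintro ⟨b, hb, h⟩
    exact ⟨_, vonNeumann_mem_levels.2 hb, h⟩
  · rintro ⟨w, hw, h⟩
    obtain ⟨b, hb, rfl⟩ := mem_levels.1 hw
    exact ⟨b, hb, h⟩

theorem mem_j_vonNeumann (hM : TransClass M) {o : Ordinal.{u}} {z : ZFSet.{u}} (hz : z ∈ M) :
    z ∈ e.j (vonNeumann o) ↔ z.rank < (e.j (vonNeumann o)).rank := by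
  refine ⟨ZFSet.rank_lt_of_mem, fun h => ?_⟩
  obtain ⟨y, hy, hzy⟩ := ZFSet.lt_rank_iff.1 h
  obtain ⟨w, hw, hyw⟩ := (e.mem_j_vonNeumann_iff hM (hM _ (e.j_mem_class _) _ hy)).1 hy
  refine (e.mem_j_vonNeumann_iff hM hz).2 ⟨w, hw, fun x hx => ?_⟩
  exact (e.mem_j_level hM w hw x (hM _ hz _ hx)).2
    ((ZFSet.rank_lt_of_mem hx).trans_le (hzy.trans (ZFSet.rank_mono hyw)))

/-- A level of the cumulative hierarchy lying in the image of a level is an image level. -/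
theorem vonNeumann_mem_j_levels (hM : TransClass M) {b o : Ordinal.{u}}
    (h : vonNeumann b ∈ e.j (vonNeumann o)) (hb : ∀ x : ZFSet.{u}, x.rank < b → x ∈ M) :
    vonNeumann b ∈ e.j (levels o) := by
  have hbM : vonNeumann b ∈ M := hM _ (e.j_mem_class _) _ h
  obtain ⟨w, ⟨hw, hbw⟩, hmin⟩ := ZFSet.mem_wf.has_min {w | w ∈ e.j (levels o) ∧ vonNeumann b ⊆ w}
    ((e.mem_j_vonNeumann_iff hM hbM).1 h)
  have hwM : w ∈ M := hM _ (e.j_mem_class _) _ hw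
  have hwb : vonNeumann b ∉ w := by
    intro hbw'
    have hd : Dfn.{u} (fun M (v : Fin 1 → ZFSet.{u}) => ∀ x ∈ v 0, ∀ z ∈ x,
        ∃ w ∈ v 0, w ∈ x ∧ z ⊆ w) := by
      apply_rules [Dfn.all, Dfn.ball, Dfn.iff, Dfn.bex, Dfn.and, Dfn.mem, Dfn.subset]
    obtain ⟨w', hw', h1, h2⟩ := (e.transfer hM hd ![levels o]).1 (by
      intro x hx z hz
      obtain ⟨a, ha, rfl⟩ := mem_levels.1 hx
      obtain ⟨b, hb, h⟩ := ZFSet.mem_vonNeumann'.1 hz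
      exact ⟨_, vonNeumann_mem_levels.2 (hb.trans ha),
        ZFSet.vonNeumann_mem_vonNeumann_iff.2 hb, h⟩) w hw _ hbw'
    exact hmin w' ⟨hw', h2⟩ h1
  rw [e.mem_j_level hM w hw _ hbM, ZFSet.rank_vonNeumann, not_lt] at hwb
  have : w = vonNeumann b := by
    ext z
    rw [ZFSet.mem_vonNeumann]
    exact ⟨fun hz => (ZFSet.rank_lt_of_mem hz).trans_le hwb, fun hz => hbw
      (ZFSet.mem_vonNeumann.2 hz)⟩
  exact this ▸ hw

end LaverDiamond.ClassEmb

theorem Dfn.isOrdinal {n : ℕ} (i : Fin n) : Dfn.{u} (fun _ v => (v i).IsOrdinal) := by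
  have h : Dfn.{u} (fun _ (v : Fin n → ZFSet.{u}) => (∀ y ∈ v i, ∀ z ∈ y, z ∈ v i) ∧
      ∀ w ∈ v i, ∀ z ∈ w, ∀ y ∈ z, y ∈ w) := by
    apply_rules [and, ball, mem]
  refine h.congr fun M hM v hv => ?_
  constructor
  · rintro ⟨h1, h2⟩
    exact ⟨fun y hy z hz => h1 y hy z hz, fun hy hz hw => h2 _ hw _ hz _ hy⟩
  · intro h
    exact ⟨fun y hy z hz => h.1 y hy hz, fun w hw z hz y hy => h.2 hy hz hw⟩

namespace LaverDiamond.CritPt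

variable {M : Set ZFSet.{u}} {e : ClassEmb V.{u} M} {κ : ZFSet.{u}}

theorem insert_mem (h : CritPt e.j κ) (hM : TransClass M) {α : ZFSet.{u}} (hα : α ∈ κ) :
    insert α α ∈ κ := by
  have hαo := h.1.mem hα
  rcases (ZFSet.isOrdinal_succ hαo).mem_trichotomous h.1 with h1 | h1 | h1
  · exact h1
  · have hd : Dfn.{u} (fun M (v : Fin 2 → ZFSet.{u}) => ∀ x ∈ v 0, x = v 1 ∨ x ∈ v 1) := by
      apply_rules [Dfn.ball, Dfn.or, Dfn.mem, Dfn.eq]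
    have := (e.transfer hM hd ![κ, α]).1 (fun x hx => by
      have hx : x ∈ insert α α := h1 ▸ hx
      exact ZFSet.mem_insert_iff.1 hx) κ h.2.1
    simp only [Matrix.cons_val] at this
    rw [h.2.2 α hαo hα] at this
    rcases this with h2 | h2
    · exact (ZFSet.mem_irrefl α (by rwa [h2] at hα)).elim
    · exact (ZFSet.mem_asymm hα h2).elim
  · rcases ZFSet.mem_insert_iff.1 h1 with h2 | h2
    · exact (ZFSet.mem_irrefl α (by rwa [h2] at hα)).elim
    · exact (ZFSet.mem_asymm hα h2).elim

theorem empty_mem (h : CritPt e.j κ) (hM : TransClass M) : ∅ ∈ κ := by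
  rcases ZFSet.isOrdinal_empty.mem_trichotomous h.1 with h1 | h1 | h1
  · exact h1
  · have hd : Dfn.{u} (fun M (v : Fin 1 → ZFSet.{u}) => ∀ x ∈ v 0, ¬ x = x) := by
      apply_rules [Dfn.ball, Dfn.not, Dfn.mem, Dfn.eq]
    exact ((e.transfer hM hd ![κ]).1 (fun x hx => by
      have hx : x ∈ (∅ : ZFSet) := h1 ▸ hx
      exact (ZFSet.notMem_empty _ hx).elim) κ h.2.1 rfl).elim
  · exact (ZFSet.notMem_empty _ h1).elim

theorem isSuccLimit (h : CritPt e.j κ) (hM : TransClass M) : Order.IsSuccLimit κ.rank := by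
  rw [Order.isSuccLimit_iff, Order.isSuccPrelimit_iff_succ_lt]
  refine ⟨?_, fun a ha => ?_⟩
  · have := ZFSet.rank_lt_of_mem (h.empty_mem hM)
    exact fun hm => hm.not_lt this
  · have h1 : a.toZFSet ∈ κ := by
      rw [← (ZFSet.isOrdinal_toZFSet a).rank_lt_iff_mem h.1, Ordinal.rank_toZFSet]
      exact ha
    have := ZFSet.rank_lt_of_mem (h.insert_mem hM h1)
    rw [← Ordinal.toZFSet_add_one, Ordinal.rank_toZFSet] at this
    exact this

theorem omega0_lt (h : CritPt e.j κ) (hM : TransClass M) : Ordinal.omega0 < κ.rank := by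
  have hl := h.isSuccLimit hM
  refine lt_of_le_of_ne (Ordinal.omega0_le_of_isSuccLimit hl) fun heq => ?_
  have hd : Dfn.{u} (fun M (v : Fin 1 → ZFSet.{u}) => ∀ x ∈ v 0,
      (∃ y ∈ x, ∀ z ∈ x, z ∈ y ∨ z = y) ∨ ∀ y ∈ x, ¬ y = y) := by
    apply_rules [Dfn.ball, Dfn.bex, Dfn.not, Dfn.or, Dfn.mem, Dfn.eq]
  have := (e.transfer hM hd ![κ]).1 (by
    intro x hx
    have hxo := h.1.mem hx
    obtain ⟨n, hn⟩ := Ordinal.lt_omega0.1 ((ZFSet.rank_lt_of_mem hx).trans_eq heq.symm)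
    have hx' : x = (n : Ordinal).toZFSet := by rw [← hxo.toZFSet_rank_eq, hn]
    subst hx'
    cases n with
    | zero => right; simp
    | succ n =>
      left
      rw [Nat.cast_succ, Ordinal.toZFSet_add_one]
      exact ⟨_, ZFSet.mem_insert _ _, fun z hz => (ZFSet.mem_insert_iff.1 hz).symm⟩) κ h.2.1
  rcases this with ⟨y, hy, h1⟩ | h1
  · rcases h1 _ (h.insert_mem hM hy) with h2 | h2
    · exact ZFSet.mem_asymm (ZFSet.mem_insert y y) h2
    · exact ZFSet.mem_irrefl y (by have := ZFSet.mem_insert y y; rwa [h2] at this)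
  · exact h1 _ (h.empty_mem hM) rfl

theorem fix (h : CritPt e.j κ) (hM : TransClass M) {x : ZFSet.{u}} (hx : x.rank < κ.rank) :
    e.j x = x := by
  have hl := h.isSuccLimit hM
  have hfixo : ∀ a < κ.rank, e.j a.toZFSet = a.toZFSet := fun a ha => by
    refine h.2.2 _ (ZFSet.isOrdinal_toZFSet a) ?_
    rw [← (ZFSet.isOrdinal_toZFSet a).rank_lt_iff_mem h.1, Ordinal.rank_toZFSet]
    exact ha
  have hrank : ∀ a < κ.rank, (e.j (vonNeumann a)).rank ≤ a := by
    intro a ha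
    by_contra hlt
    rw [not_le] at hlt
    have hd : Dfn.{u} (fun M (v : Fin 2 → ZFSet.{u}) => ∀ x ∈ v 0, x.IsOrdinal → x ∈ v 1) := by
      apply_rules [Dfn.ball, Dfn.imp, Dfn.isOrdinal, Dfn.mem, Dfn.eq]
    have h1 := (e.transfer hM hd ![vonNeumann a, a.toZFSet]).1 (fun x hx hxo => by
      rw [← hxo.toZFSet_rank_eq]
      exact Ordinal.toZFSet_mem_toZFSet_iff.2 (ZFSet.mem_vonNeumann.1 hx))
    simp only [Matrix.cons_val] at h1
    rw [hfixo a ha] at h1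
    have haM : a.toZFSet ∈ M := hfixo a ha ▸ e.j_mem_class _
    exact ZFSet.mem_irrefl _ (h1 _ ((e.mem_j_vonNeumann hM haM).2 (by rwa [Ordinal.rank_toZFSet]))
      (ZFSet.isOrdinal_toZFSet a))
  induction hr : x.rank using WellFoundedLT.induction generalizing x with
  | _ r ih =>
    subst hr
    have ih' : ∀ y : ZFSet, y.rank < x.rank → e.j y = y := fun y hy => ih _ hy (hy.trans hx) rfl
    ext y
    constructor
    · intro hy
      have h1 : e.j x ⊆ e.j (vonNeumann x.rank) :=
        (e.subset_iff hM).2 (ZFSet.subset_vonNeumann.2 le_rfl)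
      have h2 : y.rank < x.rank := (ZFSet.rank_lt_of_mem (h1 hy)).trans_le (hrank _ hx)
      rwa [← ih' y h2, e.mem_iff hM] at hy
    · intro hy
      rw [← ih' y (ZFSet.rank_lt_of_mem hy)]
      exact (e.mem_iff hM).2 hy

theorem rank_lt_rank_j (h : CritPt e.j κ) (hM : TransClass M) :
    κ.rank < (e.j (vonNeumann κ.rank)).rank :=
  ZFSet.rank_lt_of_mem ((e.subset_iff hM).2 (ZFSet.subset_vonNeumann.2 le_rfl) h.2.1)

end LaverDiamond.CritPt

theorem ZFSet.rank_pair_lt {o : Ordinal.{u}} (ho : Order.IsSuccLimit o) {x y : ZFSet.{u}}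
    (hx : x.rank < o) (hy : y.rank < o) : (ZFSet.pair x y).rank < o := by
  have h1 := ho.succ_lt hx
  have h2 := ho.succ_lt hy
  rw [ZFSet.pair, ZFSet.rank_pair, ZFSet.rank_pair, ZFSet.rank_singleton]
  exact max_lt (ho.succ_lt h1) (ho.succ_lt (max_lt h1 h2))

theorem pairClosed_vonNeumann {o : Ordinal.{u}} (ho : Order.IsSuccLimit o) :
    PairClosed (vonNeumann o) := fun x hx y hy => by
  rw [ZFSet.mem_vonNeumann] at *
  exact ZFSet.rank_pair_lt ho hx hy

theorem rank_num_lt (n : ℕ) : (num.{u} n).rank < Ordinal.omega0 := by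
  rw [num, ZFSet.rank_vonNeumann]
  exact Ordinal.natCast_lt_omega0 n

theorem rank_nums_le : nums.{u}.rank ≤ Ordinal.omega0 := by
  rw [ZFSet.rank_le_iff]
  intro y hy
  obtain ⟨n, rfl⟩ := mem_nums.1 hy
  exact rank_num_lt n

/-- The elementary embedding `e` has critical point the ordinal `k`, and its target contains all
sets of rank less than `t`. -/
structure StrongFor (k t : Ordinal.{u}) {M : Set ZFSet.{u}} (e : ClassEmb V.{u} M) : Prop where
  trans : TransClass M
  crit : CritPt e.j k.toZFSet
  sub : ∀ x : ZFSet.{u}, x.rank < t → x ∈ M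

namespace StrongFor

variable {k t : Ordinal.{u}} {M : Set ZFSet.{u}} {e : ClassEmb V.{u} M}

theorem isSuccLimit (h : StrongFor k t e) : Order.IsSuccLimit k := by
  simpa [Ordinal.rank_toZFSet] using h.crit.isSuccLimit h.trans

theorem omega0_lt (h : StrongFor k t e) : Ordinal.omega0 < k := by
  simpa [Ordinal.rank_toZFSet] using h.crit.omega0_lt h.trans

theorem fix (h : StrongFor k t e) {x : ZFSet.{u}} (hx : x.rank < k) : e.j x = x :=
  h.crit.fix h.trans (by rwa [Ordinal.rank_toZFSet])

theorem fixNums (h : StrongFor k t e) : e.FixNums :=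
  ⟨h.fix (rank_nums_le.trans_lt h.omega0_lt), fun n => h.fix ((rank_num_lt n).trans h.omega0_lt)⟩

theorem big (h : StrongFor k t e) : k < (e.j (vonNeumann k)).rank := by
  simpa [Ordinal.rank_toZFSet] using h.crit.rank_lt_rank_j h.trans

theorem mono (h : StrongFor k t e) {s : Ordinal.{u}} (hs : s ≤ t) : StrongFor k s e :=
  ⟨h.trans, h.crit, fun x hx => h.sub x (hx.trans_le hs)⟩

end StrongFor

/-- The ordinal `k` is a strong cardinal. -/
def IsStrong (k : Ordinal.{u}) : Prop :=
  ∀ t, ∃ (M : Set ZFSet.{u}) (e : ClassEmb V.{u} M), StrongFor k t e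

theorem LaverDiamond.Strong.isStrong {κ : ZFSet.{u}} (h : Strong κ) :
    IsStrong κ.rank ∧ κ = κ.rank.toZFSet := by
  obtain ⟨E⟩ := h ∅ ZFSet.isOrdinal_empty
  have hκ : κ = κ.rank.toZFSet := E.crit.1.toZFSet_rank_eq.symm
  refine ⟨fun t => ?_, hκ⟩
  obtain ⟨E⟩ := h t.toZFSet (ZFSet.isOrdinal_toZFSet t)
  exact ⟨E.M, E.e, E.trans, hκ ▸ E.crit, fun x hx => E.vsub x (by rwa [MemV, Ordinal.rank_toZFSet])⟩

/-- If every member of a family of sets is at least as large as the index set, then one can choose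
distinct elements of the members. -/
theorem exists_injective_choice {ι α : Type v} (S : ι → Set α)
    (h : ∀ i, Cardinal.mk ι ≤ Cardinal.mk (S i)) :
    ∃ c : ι → α, Function.Injective c ∧ ∀ i, c i ∈ S i := by
  classical
  obtain ⟨r, hr, hro⟩ := Cardinal.exists_ord_eq ι
  have hstep : ∀ (i : ι) (p : ∀ j, r j i → α), ∃ y ∈ S i, ∀ j hj, y ≠ p j hj := by
    intro i p
    have h1 : Cardinal.mk (Set.range fun x : {j // r j i} => p x.1 x.2) < Cardinal.mk (S i) :=
      Cardinal.mk_range_le.trans_lt ((Cardinal.card_typein_lt i hro).trans_le (h i))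
    by_contra! hc
    refine h1.not_ge (Cardinal.mk_le_mk_of_subset fun y hy => ?_)
    obtain ⟨j, hj, e⟩ := hc y hy
    exact ⟨⟨j, hj⟩, e.symm⟩
  choose f hf hf' using hstep
  let c : ι → α := hr.wf.fix (C := fun _ => α) f
  have hc : ∀ i, c i = f i (fun j _ => c j) := fun i => hr.wf.fix_eq _ i
  have hlt : ∀ i j, r j i → c i ≠ c j := fun i j hj => by
    rw [hc i]
    exact hf' i _ j hj
  refine ⟨c, fun i j hij => ?_, fun i => by rw [hc i]; exact hf i _⟩
  rcases trichotomous_of r i j with h1 | h1 | h1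
  · exact (hlt j i h1 hij.symm).elim
  · exact h1
  · exact (hlt i j h1 hij).elim

/-- A function on the countable sequences from `W` taking all values on the sequences from the range
of any injection. -/
theorem exists_onto_function {W : Type v}
    (h : Cardinal.mk ((W → W) × W) ≤ Cardinal.mk (ℕ → W)) :
    ∃ F : (ℕ → W) → W, ∀ g : W → W, Function.Injective g → ∀ a, ∃ s, F (g ∘ s) = a := by
  classical
  obtain ⟨c, hc, hcS⟩ := exists_injective_choice
    (ι := {g : W → W // Function.Injective g} × W) (α := ℕ → W)
    (fun i => Set.range fun s : ℕ → W => i.1.1 ∘ s) (by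
      intro i
      rw [Cardinal.mk_range_eq _ i.1.2.comp_left]
      refine le_trans (Cardinal.mk_le_of_injective
        (f := fun i : {g : W → W // Function.Injective g} × W => ((i.1.1, i.2) : (W → W) × W)) ?_) h
      rintro ⟨⟨g, hg⟩, a⟩ ⟨⟨g', hg'⟩, a'⟩ h
      simp only [Prod.mk.injEq] at h
      obtain ⟨rfl, rfl⟩ := h
      rfl)
  refine ⟨fun x => if h : ∃ i, c i = x then h.choose.2 else x 0, fun g hg a => ?_⟩
  obtain ⟨s, hs⟩ := hcS (⟨g, hg⟩, a)
  have hs : g ∘ s = c (⟨g, hg⟩, a) := hs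
  have hex : ∃ i, c i = g ∘ s := ⟨_, hs.symm⟩
  refine ⟨s, ?_⟩
  beta_reduce
  rw [dif_pos hex, hc (hex.choose_spec.trans hs)]

/-- If `W` is the union of an increasing chain of sets whose power sets lie in `W`, then there are as
many sequences from `W` as subsets of `W`. -/
theorem mk_fun_le_mk_seq {W : ZFSet.{u}} {K : ℕ → ZFSet.{u}}
    (hW : ∀ x, x ∈ W ↔ ∃ n, x ∈ K n) (hKW : ∀ n X, X ⊆ K n → X ∈ W) (hp : PairClosed W) :
    Cardinal.mk ((W → W) × W) ≤ Cardinal.mk (ℕ → W) := by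
  classical
  let G : (W → W) × W → ℕ → ZFSet.{u} := fun i n =>
    ZFSet.sep (fun p => ∃ x : W, p = ZFSet.pair (i.2 : ZFSet) (ZFSet.pair x (i.1 x : ZFSet))) (K n)
  have hG : ∀ i n, G i n ∈ W := fun i n => hKW n _ ZFSet.sep_subset
  refine Cardinal.mk_le_of_injective (f := fun i n => (⟨G i n, hG i n⟩ : W)) ?_
  have key : ∀ i i' : (W → W) × W, (∀ n, G i n = G i' n) → ∀ x : W, i.2 = i'.2 ∧ i.1 x = i'.1 x := by
    intro i i' h x
    have h1 : ZFSet.pair (i.2 : ZFSet) (ZFSet.pair x (i.1 x : ZFSet)) ∈ W :=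
      hp _ i.2.2 _ (hp _ x.2 _ (i.1 x).2)
    obtain ⟨n, hn⟩ := (hW _).1 h1
    have h2 : ZFSet.pair (i.2 : ZFSet) (ZFSet.pair x (i.1 x : ZFSet)) ∈ G i n :=
      ZFSet.mem_sep.2 ⟨hn, x, rfl⟩
    rw [h n] at h2
    obtain ⟨-, y, hy⟩ := ZFSet.mem_sep.1 h2
    obtain ⟨h3, h4⟩ := ZFSet.pair_inj.1 hy
    obtain ⟨h5, h6⟩ := ZFSet.pair_inj.1 h4
    have h5' : x = y := Subtype.ext h5
    subst h5'
    exact ⟨Subtype.ext h3, Subtype.ext h6⟩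
  intro i i' h
  have h' : ∀ n, G i n = G i' n := fun n => congrArg Subtype.val (congrFun h n)
  exact Prod.ext (funext fun x => (key i i' h' x).2) (key i i' h' i.2).1

/-- The relation `g` contains an injection of `W` into itself. -/
def InjRel (W g : ZFSet.{u}) : Prop :=
  (∀ x ∈ W, ∃ y ∈ W, ZFSet.pair x y ∈ g) ∧
    ∀ x ∈ W, ∀ x' ∈ W, ∀ y ∈ W, ZFSet.pair x y ∈ g → ZFSet.pair x' y ∈ g → x = x'

/-- The relation `f` takes every value in `W` on the sequences from the range of any injection. -/
def OntoIn (M : Set ZFSet.{u}) (w W f : ZFSet.{u}) : Prop :=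
  ∀ g ∈ M, InjRel W g → ∀ a ∈ W, ∃ s ∈ M, SeqIn w W s ∧ ∃ s' ∈ M, SeqIn w W s' ∧
    (∀ n ∈ w, ∀ x ∈ W, ZFSet.pair n x ∈ s → ∃ y ∈ W, ZFSet.pair n y ∈ s' ∧ ZFSet.pair x y ∈ g) ∧
    ZFSet.pair s' a ∈ f

theorem Dfn.injRel {n : ℕ} (W g : Fin n) : Dfn.{u} (fun _ v => InjRel (v W) (v g)) := by
  unfold InjRel
  apply_rules [and, ball, imp, bex, mem, eq, pair_mem]

theorem Dfn.ontoIn {n : ℕ} (w W f : Fin n) : Dfn.{u} (fun M v => OntoIn M (v w) (v W) (v f)) := by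
  unfold OntoIn
  repeat' first
    | exact mem _ _ | exact eq _ _ | exact pair_mem _ _ _ | exact injRel _ _ | exact seqIn _ _ _
    | apply all | apply ex | apply ball | apply bex | apply imp | apply and

theorem exists_ontoIn {W : ZFSet.{u}} (h : Cardinal.mk ((W → W) × W) ≤ Cardinal.mk (ℕ → W)) :
    ∃ f : ZFSet.{u}, OntoIn Set.univ nums W f ∧
      (∀ s : ℕ → ZFSet.{u}, (∀ n, s n ∈ W) → ∃ y, ZFSet.pair (seq s) y ∈ f) ∧
      ∀ s y z, ZFSet.pair s y ∈ f → ZFSet.pair s z ∈ f → y = z := by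
  obtain ⟨F, hF⟩ := exists_onto_function h
  let f : ZFSet.{u} :=
    ZFSet.range (fun s : ℕ → W => ZFSet.pair (seq fun n => (s n : ZFSet)) (F s : ZFSet))
  have hf : ∀ s y, ZFSet.pair s y ∈ f ↔ ∃ t : ℕ → W, s = (seq fun n => (t n : ZFSet)) ∧ y = F t := by
    intro s y
    simp only [f, ZFSet.mem_range]
    constructor
    · rintro ⟨t, ht⟩
      obtain ⟨h1, h2⟩ := ZFSet.pair_inj.1 ht
      exact ⟨t, h1.symm, h2.symm⟩
    · rintro ⟨t, rfl, rfl⟩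
      exact ⟨t, rfl⟩
  have hinj : ∀ t t' : ℕ → W, (seq fun n => (t n : ZFSet)) = (seq fun n => (t' n : ZFSet)) → t = t' := by
    intro t t' h
    funext n
    have h1 : ZFSet.pair (num n) (t n) ∈ seq fun n => (t n : ZFSet) := pair_mem_seq.2 rfl
    rw [h, pair_mem_seq] at h1
    exact Subtype.ext h1
  refine ⟨f, ?_, fun s hs => ⟨F fun n => ⟨s n, hs n⟩, (hf _ _).2 ⟨fun n => ⟨s n, hs n⟩, rfl, rfl⟩⟩, ?_⟩
  · intro g _ hg a ha
    choose g' hg' hgg' using hg.1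
    let G : W → W := fun x => ⟨g' x x.2, hg' x x.2⟩
    obtain ⟨s, hs⟩ := hF G (by
      intro x y hxy
      have e : g' x x.2 = g' y y.2 := congrArg Subtype.val hxy
      refine Subtype.ext (hg.2 _ x.2 _ y.2 _ (hg' x x.2) (hgg' x x.2) ?_)
      rw [e]
      exact hgg' y y.2) ⟨a, ha⟩
    refine ⟨seq fun n => (s n : ZFSet), trivial, seqIn_iff.2 ⟨_, fun n => (s n).2, rfl⟩,
      seq fun n => g' (s n) (s n).2, trivial, seqIn_iff.2 ⟨_, fun n => hg' _ _, rfl⟩, ?_,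
      (hf _ _).2 ⟨G ∘ s, rfl, (congrArg Subtype.val hs).symm⟩⟩
    intro m hm x hx hmx
    obtain ⟨n, rfl⟩ := mem_nums.1 hm
    rw [pair_mem_seq] at hmx
    subst hmx
    exact ⟨_, hg' _ _, pair_mem_seq.2 rfl, hgg' _ _⟩
  · intro s y z hy hz
    obtain ⟨t, ht, rfl⟩ := (hf _ _).1 hy
    obtain ⟨t', ht', rfl⟩ := (hf _ _).1 hz
    rw [hinj t t' (ht.symm.trans ht')]

/-- Kunen's inconsistency theorem, local version. -/
theorem StrongFor.j_vonNeumann_ne {k t o : Ordinal.{u}} {M : Set ZFSet.{u}} {e : ClassEmb V.{u} M}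
    (h : StrongFor k t e) (hk : k < o) (ho : Order.IsSuccLimit o) (ht : o < t) :
    e.j (vonNeumann o) ≠ vonNeumann o := by
  intro hfix
  have hM := h.trans
  have hsubM : ∀ {x : ZFSet.{u}}, x.rank < o → x ∈ M := fun hx => h.sub _ (hx.trans ht)
  let K : ℕ → ZFSet.{u} := fun n => e.j^[n] (vonNeumann k)
  have hKs : ∀ n, K (n + 1) = e.j (K n) := fun n => Function.iterate_succ_apply' _ _ _
  have hKo : ∀ n, K n ∈ vonNeumann o := by
    intro n
    induction n with
    | zero => exact ZFSet.vonNeumann_mem_vonNeumann_iff.2 hk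
    | succ n ih => rw [hKs, ← hfix]; exact (e.mem_iff hM).2 ih
  have hsub : ∀ n, K n ⊆ K (n + 1) := by
    intro n
    induction n with
    | zero =>
      intro x hx
      have hx' : x ∈ vonNeumann k := hx
      rw [hKs, ← h.fix (ZFSet.mem_vonNeumann.1 hx')]
      exact (e.mem_iff hM).2 hx
    | succ n ih => rw [hKs, hKs (n + 1)]; exact (e.subset_iff hM).2 ih
  have hmono : ∀ {m n}, m ≤ n → K m ⊆ K n := by
    intro m n hmn
    induction hmn with
    | refl => exact fun _ h => h
    | step _ ih => exact fun x hx => hsub _ (ih hx)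
  have hpow : ∀ n X, X ⊆ K n → X ∈ K (n + 1) := by
    intro n
    induction n with
    | zero =>
      intro X hX
      have hX : X.rank ≤ k := ZFSet.subset_vonNeumann.1 hX
      rw [hKs]
      exact (e.mem_j_vonNeumann hM (hsubM (hX.trans_lt hk))).2 (hX.trans_lt h.big)
    | succ n ih =>
      intro X hX
      have hd : Dfn.{u} (fun M (v : Fin 2 → ZFSet.{u}) => ∀ X ∈ M, X ⊆ v 0 → X ∈ v 1) := by
        apply_rules [Dfn.all, Dfn.imp, Dfn.subset, Dfn.mem]
      have := (e.transfer hM hd ![K n, K (n + 1)]).1 (fun X _ => ih X) X (hsubM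
        ((ZFSet.rank_mono hX).trans_lt (ZFSet.mem_vonNeumann.1 (hKo _))))
      simp only [Matrix.cons_val] at this
      rw [← hKs, ← hKs] at this
      exact this hX
  have hpair : ∀ n, ∀ x ∈ K n, ∀ y ∈ K n, ∃ p ∈ K n, p = ZFSet.pair x y := by
    intro n
    induction n with
    | zero => exact fun x hx y hy => ⟨_, pairClosed_vonNeumann h.isSuccLimit x hx y hy, rfl⟩
    | succ n ih =>
      have hd : Dfn.{u} (fun M (v : Fin 1 → ZFSet.{u}) =>
          ∀ x ∈ v 0, ∀ y ∈ v 0, ∃ p ∈ v 0, p = ZFSet.pair x y) := by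
        apply_rules [Dfn.ball, Dfn.bex, Dfn.eq_pair, Dfn.mem]
      rw [hKs]
      exact (e.transfer hM hd ![K n]).1 ih
  let W : ZFSet.{u} := ZFSet.sep (fun x => ∃ n, x ∈ K n) (vonNeumann o)
  have hW : ∀ x, x ∈ W ↔ ∃ n, x ∈ K n := fun x => by
    rw [ZFSet.mem_sep]
    exact ⟨fun h => h.2, fun ⟨n, hn⟩ => ⟨(ZFSet.isTransitive_vonNeumann o).mem_trans hn (hKo n),
      n, hn⟩⟩
  have hWp : PairClosed W := fun x hx y hy => by
    obtain ⟨m, hm⟩ := (hW x).1 hx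
    obtain ⟨n, hn⟩ := (hW y).1 hy
    obtain ⟨p, hp, rfl⟩ := hpair (max m n) x (hmono (le_max_left _ _) hm) y
      (hmono (le_max_right _ _) hn)
    exact (hW _).2 ⟨_, hp⟩
  have hWM : ∀ {x}, x ∈ W → x ∈ M := fun hx =>
    hsubM (ZFSet.mem_vonNeumann.1 (ZFSet.mem_sep.1 hx).1)
  have hjW : e.j W = W := by
    have hd : Dfn.{u} (fun M (v : Fin 3 → ZFSet.{u}) => ∀ x ∈ M,
        (x ∈ v 0 ↔ ∃ n ∈ v 1, ∃ y ∈ M, ZFSet.pair n y ∈ v 2 ∧ x ∈ y)) := by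
      apply_rules [Dfn.all, Dfn.iff, Dfn.bex, Dfn.ex, Dfn.and, Dfn.pair_mem, Dfn.mem]
    have := (e.transfer hM hd ![W, nums, seq K]).1 (by
      intro x _
      simp only [Matrix.cons_val]
      rw [hW]
      constructor
      · rintro ⟨n, hn⟩
        exact ⟨_, num_mem n, _, trivial, pair_mem_seq.2 rfl, hn⟩
      · rintro ⟨m, hm, y, -, hy, hx⟩
        obtain ⟨n, rfl⟩ := mem_nums.1 hm
        rw [pair_mem_seq] at hy
        exact ⟨n, hy ▸ hx⟩)
    simp only [Matrix.cons_val] at this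
    rw [h.fixNums.j_nums, h.fixNums.j_seq hM] at this
    ext x
    constructor
    · intro hx
      obtain ⟨m, hm, y, -, hy, hxy⟩ := (this x (hM _ (e.j_mem_class _) _ hx)).1 hx
      obtain ⟨n, rfl⟩ := mem_nums.1 hm
      rw [pair_mem_seq, ← hKs] at hy
      exact (hW _).2 ⟨n + 1, hy ▸ hxy⟩
    · intro hx
      obtain ⟨n, hn⟩ := (hW _).1 hx
      exact (this x (hWM hx)).2 ⟨_, num_mem n, e.j (K n), e.j_mem_class _,
        pair_mem_seq.2 rfl, hKs n ▸ hsub n hn⟩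
  obtain ⟨f, hf, hdom, hfun⟩ := exists_ontoIn
    (mk_fun_le_mk_seq hW (fun n X hX => (hW X).2 ⟨_, hpow n X hX⟩) hWp)
  let g : ZFSet.{u} := ZFSet.sep (fun p => ∃ x, p = ZFSet.pair x (e.j x)) W
  have hjmem : ∀ {x}, x ∈ W → e.j x ∈ W := fun hx => hjW ▸ (e.mem_iff hM).2 hx
  have hg : ∀ x y, ZFSet.pair x y ∈ g ↔ x ∈ W ∧ y = e.j x := by
    intro x y
    rw [ZFSet.mem_sep]
    constructor
    · rintro ⟨h1, x', hx'⟩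
      obtain ⟨rfl, rfl⟩ := ZFSet.pair_inj.1 hx'
      refine ⟨?_, rfl⟩
      obtain ⟨n, hn⟩ := (hW _).1 h1
      have hKtr : ∀ n, (K n).IsTransitive := by
        intro n
        induction n with
        | zero => exact ZFSet.isTransitive_vonNeumann k
        | succ n ih => rw [hKs]; exact e.j_trans hM ih
      refine (hW _).2 ⟨n, (hKtr n).mem_trans (y := {x}) (by simp) ((hKtr n).mem_trans ?_ hn)⟩
      simp [ZFSet.pair]
    · rintro ⟨hx, rfl⟩
      exact ⟨hWp _ hx _ (hjmem hx), x, rfl⟩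
  have hgM : g ∈ M := h.sub _ ((ZFSet.rank_mono (show g ⊆ vonNeumann o from fun p hp =>
    (ZFSet.mem_sep.1 (ZFSet.mem_sep.1 hp).1).1)).trans_lt (by rwa [ZFSet.rank_vonNeumann]))
  have hginj : InjRel W g := by
    refine ⟨fun x hx => ⟨_, hjmem hx, (hg _ _).2 ⟨hx, rfl⟩⟩, fun x hx x' hx' y hy h1 h2 => ?_⟩
    rw [← e.inj_iff hM, ← ((hg _ _).1 h1).2, ← ((hg _ _).1 h2).2]
  have hkW : k.toZFSet ∈ W := (hW _).2 ⟨1, by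
    have h1 : k.toZFSet ⊆ vonNeumann k := Ordinal.toZFSet_subset_vonNeumann k
    exact (e.subset_iff hM).2 h1 h.crit.2.1⟩
  have hf' := (e.transfer hM (Dfn.ontoIn 0 1 2) ![nums, W, f]).1 hf
  simp only [Matrix.cons_val] at hf'
  rw [h.fixNums.j_nums, hjW] at hf'
  obtain ⟨s, -, hs, s', -, hs', hss', hk'⟩ := hf' g hgM hginj _ hkW
  obtain ⟨σ, hσ, rfl⟩ := seqIn_iff.1 hs
  obtain ⟨τ, hτ, rfl⟩ := seqIn_iff.1 hs'
  have hτσ : seq τ = e.j (seq σ) := by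
    rw [h.fixNums.j_seq hM]
    congr 1
    funext n
    obtain ⟨y, -, h1, h2⟩ := hss' (num n) (num_mem n) (σ n) (hσ n) (pair_mem_seq.2 rfl)
    rw [pair_mem_seq] at h1
    rw [← h1, ((hg _ _).1 h2).2]
  obtain ⟨y, hy⟩ := hdom σ hσ
  have hy' := (e.mem_iff hM).2 hy
  rw [e.j_pair hM, ← hτσ] at hy'
  have hd : Dfn.{u} (fun M (v : Fin 1 → ZFSet.{u}) => ∀ s ∈ M, ∀ y ∈ M, ∀ z ∈ M,
      ZFSet.pair s y ∈ v 0 → ZFSet.pair s z ∈ v 0 → y = z) := by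
    apply_rules [Dfn.all, Dfn.imp, Dfn.pair_mem, Dfn.eq]
  have hjf : e.j f ∈ M := e.j_mem_class f
  have hfun' := (e.transfer hM hd ![f]).1 (fun s _ y _ z _ => hfun s y z) (seq τ)
    (hM.of_pair (hM _ hjf _ hk')).1 _ (hM.of_pair (hM _ hjf _ hk')).2 _
    (hM.of_pair (hM _ hjf _ hy')).2 hk' hy'
  have hyk : y ∈ k.toZFSet := by
    rw [← e.mem_iff hM, ← hfun']
    exact h.crit.2.1
  have hyr : y.rank < k := by simpa [Ordinal.rank_toZFSet] using ZFSet.rank_lt_of_mem hyk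
  rw [h.fix hyr] at hfun'
  exact ZFSet.mem_irrefl _ (hfun' ▸ hyk)

/-- Arbitrarily high levels of the cumulative hierarchy are closed under countable sequences. -/
theorem exists_closedIn (t : Ordinal.{u}) :
    ∃ o > t, ClosedIn Set.univ nums (vonNeumann o) := by
  let c : Cardinal.{u} := Order.succ (max Cardinal.aleph0 t.card)
  have hreg : c.IsRegular := Cardinal.isRegular_succ (le_max_left _ _)
  have hω : Cardinal.aleph0 < c := Order.lt_succ_of_le (le_max_left _ _)
  have hlim : Order.IsSuccLimit c.ord := Cardinal.isSuccLimit_ord hreg.1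
  refine ⟨c.ord, Cardinal.lt_ord.2 (Order.lt_succ_of_le (le_max_right _ _)),
    fun x hx y hy => ⟨_, pairClosed_vonNeumann hlim x hx y hy, rfl⟩, ?_⟩
  intro s _ hs
  obtain ⟨f, hf, rfl⟩ := seqIn_iff.1 hs
  rw [ZFSet.mem_vonNeumann, ← hlim.succ_lt_iff]
  refine (Order.succ_le_succ (ZFSet.rank_le_iff.2 fun p hp => ?_)).trans_lt (hlim.succ_lt
    (Ordinal.lift_iSup_add_one_lt_of_lt_cof (f := fun n => (ZFSet.pair (num n) (f n)).rank)
      (a := c.ord) (by rw [Ordinal.lift_id'.{0, u}, hreg.cof_ord]; simpa using hω) fun n => ?_))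
  · obtain ⟨n, rfl⟩ := mem_seq.1 hp
    exact Ordinal.lt_iSup_add_one (f := fun n => (ZFSet.pair (num n) (f n)).rank) n
  · refine ZFSet.rank_pair_lt hlim ((rank_num_lt n).trans_le ?_) (ZFSet.mem_vonNeumann.1 (hf n))
    exact Ordinal.omega0_le_of_isSuccLimit hlim

theorem isSuccLimit_of_pairClosed {o : Ordinal.{u}} (h : PairClosed (vonNeumann o)) (ho : 0 < o) :
    Order.IsSuccLimit o := by
  rw [Order.isSuccLimit_iff, Order.isSuccPrelimit_iff_succ_lt]
  refine ⟨fun hm => hm.not_lt ho, fun a ha => ?_⟩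
  have ha' := ZFSet.vonNeumann_mem_vonNeumann_iff.2 ha
  have := ZFSet.mem_vonNeumann.1 (h _ ha' _ ha')
  rw [ZFSet.pair, ZFSet.rank_pair, ZFSet.rank_singleton, ZFSet.rank_vonNeumann] at this
  exact (Order.lt_succ _).trans ((le_max_left _ _).trans_lt this)

/-- Restricting the support of an extender that lies in a transitive class to a set `L` whose
subsets are sufficiently absolute. -/
theorem ExtenderIn.exists_restrict {N : Set ZFSet.{u}} {F K W L : ZFSet.{u}}
    (h : ExtenderIn N nums F K W) (hN : TransClass N) (hLN : ∀ x ∈ L, x ∈ N)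
    (hL : L.IsTransitive) (hLc : ClosedIn Set.univ nums L) (hKL : ∀ X, X ⊆ K → X ∈ L)
    (hLW : L ⊆ W) :
    ∃ E, (∀ u X, ZFSet.pair u X ∈ E ↔ u ∈ L ∧ ZFSet.pair u X ∈ F) ∧ Extender E K L := by
  classical
  let E : ZFSet.{u} := ZFSet.sep (fun p => ∃ u X, u ∈ L ∧ p = ZFSet.pair u X) F
  have hE : ∀ u X, ZFSet.pair u X ∈ E ↔ u ∈ L ∧ ZFSet.pair u X ∈ F := by
    intro u X
    rw [ZFSet.mem_sep]
    constructor
    · rintro ⟨h1, u', X', h2, h3⟩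
      obtain ⟨rfl, rfl⟩ := ZFSet.pair_inj.1 h3
      exact ⟨h2, h1⟩
    · exact fun h => ⟨h.2, u, X, h.1, rfl⟩
  have hX : ∀ {u X}, ZFSet.pair u X ∈ F → X ⊆ K := fun h' => by
    obtain ⟨u', _, X', _, h1, h2⟩ := h.1 _ h'
    obtain ⟨rfl, rfl⟩ := ZFSet.pair_inj.1 h2
    exact h1
  have hXN : ∀ X, X ⊆ K → X ∈ N := fun X h' => hLN _ (hKL X h')
  refine ⟨E, hE, ?_, ?_, ?_, ?_⟩
  · intro p hp
    obtain ⟨h1, u, X, hu, rfl⟩ := ZFSet.mem_sep.1 hp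
    exact ⟨u, hu, X, hX h1, rfl⟩
  · intro u hu X X' h1 h2 h3
    exact (h.2.1 u (hLW hu) X (hXN X h1) X' (hXN X' h2) h1 h2 h3).imp
      (fun h => (hE _ _).2 ⟨hu, h⟩) (fun h => (hE _ _).2 ⟨hu, h⟩)
  · intro u X huX
    have h1 : seq (fun n => ZFSet.pair (u n) (X n)) ∈ N := hLN _ (hLc.seq_mem trivial fun n =>
      hLc.pairClosed _ ((hE _ _).1 (huX n)).1 _ (hKL _ (hX ((hE _ _).1 (huX n)).2)))
    obtain ⟨x, -, hx⟩ := (starIn_iff hN h1).1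
      (h.2.2.1 _ h1 (seqIn_iff.2 ⟨_, fun n => ((hE _ _).1 (huX n)).2, rfl⟩))
    exact ⟨x, hx⟩
  · intro R Y hR hY h1 a ha u hu haY
    obtain ⟨v, hv, h2⟩ := h.2.2.2 R (hXN R hR) Y (hXN Y hY) hR hY h1 a (hLW ha) u (hLW hu)
      ((hE _ _).1 haY).2
    exact ⟨v, hv, (hE _ _).2 ⟨hLc.pairClosed _ ha _ (hL.mem_trans hv hu), h2⟩⟩

theorem Extender.full_mem {E K U u : ZFSet.{u}} (h : Extender E K U) (hu : u ∈ U) :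
    ZFSet.pair u K ∈ E :=
  (h.ultra u hu K K subset_rfl subset_rfl fun x hx => Or.inl hx).elim id id

theorem LaverDiamond.ClassEmb.j_pairClosed {M : Set ZFSet.{u}} (e : ClassEmb V.{u} M)
    (hM : TransClass M) {K : ZFSet.{u}} (h : PairClosed K) : PairClosed (e.j K) := by
  have hd : Dfn.{u} (fun M (v : Fin 1 → ZFSet.{u}) =>
      ∀ x ∈ v 0, ∀ y ∈ v 0, ∃ p ∈ v 0, p = ZFSet.pair x y) := by
    apply_rules [Dfn.ball, Dfn.bex, Dfn.eq_pair, Dfn.mem]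
  have := (e.transfer hM hd ![K]).1 (fun x hx y hy => ⟨_, h x hx y hy, rfl⟩)
  intro x hx y hy
  obtain ⟨p, hp, rfl⟩ := this x hx y hy
  exact hp

/-- If `k` is a strong cardinal, then there are extenders with arbitrarily large supports. -/
theorem IsStrong.exists_extender {k : Ordinal.{u}} (hk : IsStrong k) :
    ∀ o > k, ClosedIn Set.univ nums (vonNeumann o) →
      ∃ E, Extender E (vonNeumann k) (vonNeumann o) := by
  intro o
  induction o using WellFoundedLT.induction with
  | _ o ih =>
  intro hko ho
  obtain ⟨M, e, h⟩ := hk (Order.succ o)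
  have hM := h.trans
  have hlt : ∀ {a}, a ≤ o → a < Order.succ o := Order.lt_succ_of_le
  have holim := isSuccLimit_of_pairClosed ho.pairClosed (bot_le.trans_lt hko)
  have hωo : Ordinal.omega0 < o := h.omega0_lt.trans hko
  have hfix : ∀ x ∈ vonNeumann k, e.j x = x := fun x hx => h.fix (ZFSet.mem_vonNeumann.1 hx)
  have hoM : ∀ x ∈ vonNeumann o, x ∈ M := fun x hx => h.sub x (hlt (ZFSet.mem_vonNeumann.1 hx).le)
  set K₁ := e.j (vonNeumann k) with hK₁
  rcases le_or_gt o K₁.rank with hor | hro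
  · obtain ⟨E, -, hE⟩ := e.exists_extender hM h.fixNums hfix (ZFSet.isTransitive_vonNeumann o)
      ho.pairClosed (fun x hx => (e.mem_j_vonNeumann hM (hoM x hx)).2
        ((ZFSet.mem_vonNeumann.1 hx).trans_le hor))
      (fun f hf => hoM _ (ho.seq_mem trivial hf))
    exact ⟨E, hE⟩
  · have hK₁o : K₁ ∈ vonNeumann o := ZFSet.mem_vonNeumann.2 hro
    have hδ : o < (e.j (vonNeumann o)).rank := by
      have h1 := e.rank_le hM (vonNeumann o)
      rw [ZFSet.rank_vonNeumann] at h1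
      refine lt_of_le_of_ne h1 fun h2 => h.j_vonNeumann_ne hko holim (hlt le_rfl) ?_
      ext z
      refine ⟨fun hz => ZFSet.mem_vonNeumann.2 (h2 ▸ ZFSet.rank_lt_of_mem hz), fun hz => ?_⟩
      exact (e.mem_j_vonNeumann hM (hoM z hz)).2 (h2 ▸ ZFSet.mem_vonNeumann.1 hz)
    have hVM : vonNeumann o ∈ M := h.sub _ (by rw [ZFSet.rank_vonNeumann]; exact hlt le_rfl)
    have hVl : vonNeumann o ∈ e.j (levels o) := e.vonNeumann_mem_j_levels hM
      ((e.mem_j_vonNeumann hM hVM).2 (by rwa [ZFSet.rank_vonNeumann]))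
      (fun x hx => h.sub x (hlt hx.le))
    have hd : Dfn.{u} (fun M (v : Fin 3 → ZFSet.{u}) => ∀ U ∈ v 0, v 2 ∈ U → ClosedIn M (v 1) U →
        ∃ E ∈ M, ExtenderIn M (v 1) E (v 2) U) := by
      apply_rules [Dfn.ball, Dfn.imp, Dfn.ex, Dfn.mem, Dfn.closedIn, Dfn.extenderIn]
    have h1 := (e.transfer hM hd ![levels o, nums, vonNeumann k]).1 (by
      intro U hU hkU hUc
      obtain ⟨a, ha, rfl⟩ := mem_levels.1 hU
      obtain ⟨E, hE⟩ := ih a ha (ZFSet.vonNeumann_mem_vonNeumann_iff.1 hkU) hUc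
      exact ⟨E, trivial, extenderIn_univ.2 hE⟩)
    simp only [Matrix.cons_val] at h1
    rw [h.fixNums.j_nums] at h1
    obtain ⟨F₁, -, hF₁⟩ := h1 _ hVl hK₁o (ho.mono (Set.subset_univ _))
    have hpow : ∀ {K : ZFSet.{u}}, K ∈ vonNeumann o → ∀ X, X ⊆ K → X ∈ vonNeumann o := fun hK X hX =>
      ZFSet.mem_vonNeumann.2 ((ZFSet.rank_mono hX).trans_lt (ZFSet.mem_vonNeumann.1 hK))
    have hVt := ZFSet.isTransitive_vonNeumann.{u} o
    obtain ⟨E₁, -, hE₁⟩ := hF₁.exists_restrict hM hoM hVt ho (hpow hK₁o) subset_rfl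
    have hK₁t : K₁.IsTransitive := e.j_trans hM (ZFSet.isTransitive_vonNeumann k)
    have hK₁p : PairClosed K₁ := e.j_pairClosed hM (pairClosed_vonNeumann h.isSuccLimit)
    have hK₁V : K₁ ⊆ vonNeumann o := fun x hx => hVt.mem_trans hx hK₁o
    have hmemK₁ : ∀ {x : ZFSet.{u}}, x.rank ≤ k → x ∈ K₁ := fun hx =>
      (e.mem_j_vonNeumann hM (h.sub _ (hlt (hx.trans hko.le)))).2 (hx.trans_lt h.big)
    obtain ⟨N, i, hN, hifix, hVN, hi⟩ := Extender.Nice.exists_emb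
      ⟨hE₁, hK₁t, hVt, hK₁p, ho.pairClosed, hK₁V, hmemK₁ (by simp)⟩
    obtain ⟨E₂, -, hE₂⟩ := e.exists_extender hM h.fixNums hfix hK₁t hK₁p subset_rfl
      (fun f hf => hoM _ (ho.seq_mem trivial fun n => hK₁V (hf n)))
    have h2 := (i.transfer hN (Dfn.extenderIn 0 1 2 3) ![nums, E₂, vonNeumann k, K₁]).1
      (extenderIn_univ.2 hE₂)
    simp only [Matrix.cons_val] at h2
    rw [hifix nums (hmemK₁ (rank_nums_le.trans h.omega0_lt.le)),
      hifix (vonNeumann k) (hmemK₁ (ZFSet.rank_vonNeumann k).le)] at h2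
    obtain ⟨E, -, hE⟩ := h2.exists_restrict hN hVN hVt ho
      (hpow (ZFSet.vonNeumann_mem_vonNeumann_iff.2 hko))
      (fun x hx => hi x hx K₁ (hE₁.full_mem hx))
    exact ⟨E, hE⟩

/-- Construction of a partial function by recursion, with the values chosen according to `P`. -/
theorem exists_recursive {k : Ordinal.{u}} (hk : Order.IsSuccLimit k)
    (P : Ordinal.{u} → ZFSet.{u} → ZFSet.{u} → Prop) :
    ∃ ℓ : ZFSet.{u}, (∀ p ∈ ℓ, ∃ γ < k, ∃ A, A.rank < k ∧ p = ZFSet.pair γ.toZFSet A) ∧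
      (∀ γ A B, ZFSet.pair γ A ∈ ℓ → ZFSet.pair γ B ∈ ℓ → A = B) ∧
      ∀ γ < k, (∀ A, ZFSet.pair γ.toZFSet A ∈ ℓ → P γ (ℓ ∩ vonNeumann γ) A) ∧
        ∀ A, A.rank < k → P γ (ℓ ∩ vonNeumann γ) A → ∃ B, ZFSet.pair γ.toZFSet B ∈ ℓ := by
  classical
  let R : (γ : Ordinal.{u}) → ((δ : Ordinal.{u}) → δ < γ → ZFSet.{u} → Prop) → ZFSet.{u} :=
    fun γ f => ZFSet.sep (fun p => ∃ δ, ∃ h : δ < γ, ∃ A, f δ h A ∧ p = ZFSet.pair δ.toZFSet A)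
      (vonNeumann γ)
  let F : Ordinal.{u} → ZFSet.{u} → Prop := WellFounded.fix (C := fun _ => ZFSet.{u} → Prop)
    (wellFounded_lt (α := Ordinal.{u}))
    fun γ f A => ∃ h : ∃ A, A.rank < k ∧ P γ (R γ f) A, A = h.choose
  have hF : ∀ γ A, F γ A ↔
      ∃ h : ∃ A, A.rank < k ∧ P γ (R γ fun δ _ => F δ) A, A = h.choose := by
    intro γ A
    rw [show F γ = _ from WellFounded.fix_eq _ _ _]
  clear_value F
  have hFk : ∀ {γ A}, F γ A → A.rank < k ∧ P γ (R γ fun δ _ => F δ) A := by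
    intro γ A h
    obtain ⟨h', rfl⟩ := (hF γ A).1 h
    exact h'.choose_spec
  let ℓ : ZFSet.{u} := ZFSet.sep (fun p => ∃ δ < k, ∃ A, F δ A ∧ p = ZFSet.pair δ.toZFSet A)
    (vonNeumann k)
  have hℓ : ∀ γ A, ZFSet.pair γ A ∈ ℓ ↔ ∃ δ < k, γ = δ.toZFSet ∧ F δ A := by
    intro γ A
    rw [ZFSet.mem_sep]
    constructor
    · rintro ⟨-, δ, hδ, B, hB, h⟩
      obtain ⟨rfl, rfl⟩ := ZFSet.pair_inj.1 h
      exact ⟨δ, hδ, rfl, hB⟩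
    · rintro ⟨δ, hδ, rfl, hA⟩
      exact ⟨ZFSet.mem_vonNeumann.2 (ZFSet.rank_pair_lt hk (by rwa [Ordinal.rank_toZFSet])
        (hFk hA).1), δ, hδ, A, hA, rfl⟩
  have hfst : ∀ {δ : Ordinal.{u}} {A : ZFSet.{u}}, δ < (ZFSet.pair δ.toZFSet A).rank := by
    intro δ A
    have h1 : ({δ.toZFSet} : ZFSet.{u}) ∈ ZFSet.pair δ.toZFSet A := by simp [ZFSet.pair]
    have h2 := ZFSet.rank_lt_of_mem h1
    rw [ZFSet.rank_singleton, Ordinal.rank_toZFSet] at h2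
    exact (Order.lt_succ δ).trans h2
  have hR : ∀ γ < k, (R γ fun δ _ => F δ) = ℓ ∩ vonNeumann γ := by
    intro γ hγ
    ext p
    rw [ZFSet.mem_inter, ZFSet.mem_sep]
    constructor
    · rintro ⟨hp, δ, hδ, A, hA, rfl⟩
      exact ⟨(hℓ _ _).2 ⟨δ, hδ.trans hγ, rfl, hA⟩, hp⟩
    · rintro ⟨hp, hpγ⟩
      obtain ⟨-, δ, hδ, A, hA, rfl⟩ := ZFSet.mem_sep.1 hp
      exact ⟨hpγ, δ, hfst.trans (ZFSet.mem_vonNeumann.1 hpγ), A, hA, rfl⟩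
  refine ⟨ℓ, fun p hp => ?_, fun γ A B hA hB => ?_, fun γ hγ => ⟨fun A hA => ?_, fun A hA hP => ?_⟩⟩
  · obtain ⟨-, δ, hδ, A, hA, rfl⟩ := ZFSet.mem_sep.1 hp
    exact ⟨δ, hδ, A, (hFk hA).1, rfl⟩
  · obtain ⟨δ, -, rfl, h1⟩ := (hℓ _ _).1 hA
    obtain ⟨δ', -, h, h2⟩ := (hℓ _ _).1 hB
    obtain rfl := Ordinal.toZFSet_injective h
    obtain ⟨_, rfl⟩ := (hF _ _).1 h1
    obtain ⟨_, rfl⟩ := (hF _ _).1 h2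
    rfl
  · obtain ⟨δ, -, h, h1⟩ := (hℓ _ _).1 hA
    obtain rfl := Ordinal.toZFSet_injective h
    exact hR γ hγ ▸ (hFk h1).2
  · rw [← hR γ hγ] at hP
    exact ⟨_, (hℓ _ _).2 ⟨γ, hγ, rfl, (hF _ _).2 ⟨⟨A, hA, hP⟩, rfl⟩⟩⟩

/-- In the class `M`, no extender over `v` with support `U` sends `r` to a set that contains the
pair of `γ` and `A`. -/
def Unanticipated (M : Set ZFSet.{u}) (w v γ r U A : ZFSet.{u}) : Prop :=
  v ∈ U ∧ γ ∈ U ∧ A ∈ U ∧ ClosedIn M w U ∧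
    ¬ ∃ E ∈ M, ExtenderIn M w E v U ∧ ZFSet.pair (ZFSet.pair γ A) r ∈ E

theorem Dfn.unanticipated {n : ℕ} (w v γ r U A : Fin n) :
    Dfn.{u} (fun M f => Unanticipated M (f w) (f v) (f γ) (f r) (f U) (f A)) := by
  unfold Unanticipated
  repeat' first
    | exact mem _ _ | exact pair_pair_mem _ _ _ _ | exact closedIn _ _ | exact extenderIn _ _ _ _
    | apply ex | apply and | apply not

/-- `A` is unanticipated for the support `U`, and `U` is the least such element of `H`. -/
def LeastUnanticipated (M : Set ZFSet.{u}) (H w v γ r U A : ZFSet.{u}) : Prop :=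
  Unanticipated M w v γ r U A ∧ ∀ U' ∈ H, U' ∈ U → ∀ A' ∈ U', ¬ Unanticipated M w v γ r U' A'

theorem Dfn.leastUnanticipated {n : ℕ} (H w v γ r U A : Fin n) :
    Dfn.{u} (fun M f => LeastUnanticipated M (f H) (f w) (f v) (f γ) (f r) (f U) (f A)) := by
  unfold LeastUnanticipated
  repeat' first
    | exact mem _ _ | exact unanticipated _ _ _ _ _ _ | apply not | apply ball | apply imp
    | apply and

/-- In the class `M`, the partial function `ℓ` picks a minimal unanticipated set, if there is
any. -/
def IsLaver (M : Set ZFSet.{u}) (ℓ H w κ : ZFSet.{u}) : Prop :=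
  ∀ γ ∈ κ, ∀ v ∈ H, ∀ r ∈ M, γ ⊆ v → γ ∉ v → (∀ p ∈ M, p ∈ r ↔ p ∈ ℓ ∧ p ∈ v) →
    (∀ U ∈ H, ∀ A ∈ U, Unanticipated M w v γ r U A → ∃ B ∈ M, ZFSet.pair γ B ∈ ℓ) ∧
    ∀ A ∈ M, ZFSet.pair γ A ∈ ℓ → ∃ U ∈ H, LeastUnanticipated M H w v γ r U A

theorem Dfn.isLaver {n : ℕ} (ℓ H w κ : Fin n) :
    Dfn.{u} (fun M f => IsLaver M (f ℓ) (f H) (f w) (f κ)) := by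
  unfold IsLaver
  repeat' first
    | exact mem _ _ | exact subset _ _ | exact pair_mem _ _ _ | exact unanticipated _ _ _ _ _ _
    | exact leastUnanticipated _ _ _ _ _ _ _
    | apply all | apply ex | apply ball | apply bex | apply not | apply imp | apply and | apply iff

theorem exists_isLaver {k : Ordinal.{u}} (hk : Order.IsSuccLimit k) :
    ∃ ℓ : ZFSet.{u}, IsPFun k.toZFSet ℓ ∧ ℓ ⊆ vonNeumann k ∧
      IsLaver Set.univ ℓ (levels k) nums k.toZFSet := by
  obtain ⟨ℓ, h1, h2, h3⟩ := exists_recursive hk fun γ r A => ∃ U ∈ levels k,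
    LeastUnanticipated Set.univ (levels k) nums (vonNeumann γ) γ.toZFSet r U A
  refine ⟨ℓ, ⟨fun p hp => ?_, h2⟩, fun p hp => ?_, ?_⟩
  · obtain ⟨γ, hγ, A, hA, rfl⟩ := h1 p hp
    exact ⟨_, A, Ordinal.toZFSet_mem_toZFSet_iff.2 hγ, by rwa [MemV, Ordinal.rank_toZFSet], rfl⟩
  · obtain ⟨γ, hγ, A, hA, rfl⟩ := h1 p hp
    exact ZFSet.mem_vonNeumann.2 (ZFSet.rank_pair_lt hk (by rwa [Ordinal.rank_toZFSet]) hA)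
  · intro γ hγ v hv r _ hγv hγv' hr
    obtain ⟨a, ha, rfl⟩ := mem_levels.1 hv
    have hγo : γ.IsOrdinal := (ZFSet.isOrdinal_toZFSet k).mem hγ
    have hγr : γ.rank = a := le_antisymm (ZFSet.subset_vonNeumann.1 hγv)
      (not_lt.1 fun h => hγv' (ZFSet.mem_vonNeumann.2 h))
    obtain rfl : γ = a.toZFSet := by rw [← hγr, hγo.toZFSet_rank_eq]
    obtain rfl : r = ℓ ∩ vonNeumann a := by
      ext p
      rw [ZFSet.mem_inter]
      exact hr p trivial
    refine ⟨fun U hU A hA hUA => ?_, fun A _ hA => (h3 a ha).1 A hA⟩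
    obtain ⟨U, ⟨hU, A, hA, hUA⟩, hmin⟩ := ZFSet.mem_wf.has_min
      {U | U ∈ levels k ∧ ∃ A ∈ U, Unanticipated Set.univ nums (vonNeumann a) a.toZFSet
        (ℓ ∩ vonNeumann a) U A} ⟨U, hU, A, hA, hUA⟩
    obtain ⟨b, hb, rfl⟩ := mem_levels.1 hU
    obtain ⟨B, hB⟩ := (h3 a ha).2 A ((ZFSet.mem_vonNeumann.1 hA).trans hb)
      ⟨_, hU, hUA, fun U' hU' hlt A' hA' h => hmin U' ⟨hU', A', hA', h⟩ hlt⟩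
    exact ⟨B, trivial, hB⟩

theorem LaverDiamond.ClassEmb.critPt_of_mem {k : Ordinal.{u}} {M : Set ZFSet.{u}}
    (e : ClassEmb V.{u} M) (hM : TransClass M) (hfix : ∀ x ∈ vonNeumann k, e.j x = x)
    (hk : k.toZFSet ∈ e.j (vonNeumann k)) : CritPt e.j k.toZFSet := by
  refine ⟨ZFSet.isOrdinal_toZFSet k, ?_, fun α _ hα => hfix α
    (Ordinal.toZFSet_subset_vonNeumann k hα)⟩
  have hd : Dfn.{u} (fun M (v : Fin 2 → ZFSet.{u}) => ∀ x ∈ v 0, x.IsOrdinal → x ∈ v 1) := by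
    apply_rules [Dfn.ball, Dfn.imp, Dfn.isOrdinal, Dfn.mem]
  refine (e.transfer hM hd ![vonNeumann k, k.toZFSet]).1 (fun x hx hxo => ?_) _ hk
    (ZFSet.isOrdinal_toZFSet k)
  rw [← hxo.toZFSet_rank_eq]
  exact Ordinal.toZFSet_mem_toZFSet_iff.2 (ZFSet.mem_vonNeumann.1 hx)

/-- Extenders over the level `k` with support a larger closed level give strongness embeddings. -/
theorem Extender.exists_strongFor {k o : Ordinal.{u}} {E : ZFSet.{u}} (hk : Order.IsSuccLimit k)
    (hko : k < o) (ho : ClosedIn Set.univ nums (vonNeumann o))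
    (hE : Extender E (vonNeumann k) (vonNeumann o)) :
    ∃ (M : Set ZFSet.{u}) (e : ClassEmb V.{u} M), StrongFor k o e ∧
      vonNeumann o ⊆ e.j (vonNeumann k) ∧
      ∀ u ∈ vonNeumann o, ∀ X, ZFSet.pair u X ∈ E → u ∈ e.j X := by
  obtain ⟨M, e, hM, hfix, hsub, he⟩ := Extender.Nice.exists_emb
    ⟨hE, ZFSet.isTransitive_vonNeumann k, ZFSet.isTransitive_vonNeumann o,
      pairClosed_vonNeumann hk, ho.pairClosed,
      fun x hx => ZFSet.mem_vonNeumann.2 ((ZFSet.mem_vonNeumann.1 hx).trans hko),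
      ZFSet.mem_vonNeumann.2 (by simpa using hk.bot_lt)⟩
  have hsubj : vonNeumann o ⊆ e.j (vonNeumann k) := fun u hu => he u hu _ (hE.full_mem hu)
  refine ⟨M, e, ⟨hM, e.critPt_of_mem hM hfix (hsubj (ZFSet.mem_vonNeumann.2 ?_)),
    fun x hx => hsub x (ZFSet.mem_vonNeumann.2 hx)⟩, hsubj, he⟩
  rwa [Ordinal.rank_toZFSet]

/-- Every set is anticipated by a Laver function. -/
theorem IsLaver.exists_extender {k : Ordinal.{u}} (hk : IsStrong k) {ℓ : ZFSet.{u}}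
    (hℓ : ℓ ⊆ vonNeumann k) (h : IsLaver Set.univ ℓ (levels k) nums k.toZFSet)
    {o : Ordinal.{u}} (hko : k < o) (ho : ClosedIn Set.univ nums (vonNeumann o))
    {A : ZFSet.{u}} (hA : A ∈ vonNeumann o) :
    ∃ E, Extender E (vonNeumann k) (vonNeumann o) ∧
      ZFSet.pair (ZFSet.pair k.toZFSet A) ℓ ∈ E := by
  by_contra hne
  have hkl : Order.IsSuccLimit k := by
    obtain ⟨M, e, he⟩ := hk 0
    exact he.isSuccLimit
  obtain ⟨t, hot, ht⟩ := exists_closedIn o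
  obtain ⟨E₀, hE₀⟩ := hk.exists_extender t (hko.trans hot) ht
  obtain ⟨M, e, he, hsub, -⟩ := hE₀.exists_strongFor hkl (hko.trans hot) ht
  have hM := he.trans
  have hlevel : ∀ {a}, a < t → vonNeumann a ∈ e.j (levels k) := fun ha =>
    e.vonNeumann_mem_j_levels hM (hsub (ZFSet.vonNeumann_mem_vonNeumann_iff.2 ha))
      (fun x hx => he.sub x (hx.trans ha))
  have hoM : ∀ x ∈ vonNeumann o, x ∈ M := fun x hx =>
    he.sub x ((ZFSet.mem_vonNeumann.1 hx).trans hot)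
  have hfix : ∀ x ∈ vonNeumann k, e.j x = x := fun x hx => he.fix (ZFSet.mem_vonNeumann.1 hx)
  have hkV : vonNeumann k ∈ vonNeumann o := ZFSet.vonNeumann_mem_vonNeumann_iff.2 hko
  have hkO : k.toZFSet ∈ vonNeumann o := ZFSet.mem_vonNeumann.2 (by rwa [Ordinal.rank_toZFSet])
  have hpow : ∀ X, X ⊆ vonNeumann k → X ∈ vonNeumann o := fun X hX =>
    ZFSet.mem_vonNeumann.2 ((ZFSet.rank_mono hX).trans_lt (ZFSet.mem_vonNeumann.1 hkV))
  have hL := (e.transfer hM (Dfn.isLaver 0 1 2 3) ![ℓ, levels k, nums, k.toZFSet]).1 h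
  simp only [Matrix.cons_val] at hL
  rw [he.fixNums.j_nums] at hL
  obtain ⟨hL1, hL2⟩ := hL k.toZFSet he.crit.2.1 _ (hlevel (hko.trans hot)) ℓ (hoM _ (hpow _ hℓ))
    (Ordinal.toZFSet_subset_vonNeumann k)
    (fun h => by simpa [Ordinal.rank_toZFSet] using ZFSet.mem_vonNeumann.1 h) (by
      intro p _
      constructor
      · intro hp
        refine ⟨?_, hℓ hp⟩
        rw [← hfix p (hℓ hp)]
        exact (e.mem_iff hM).2 hp
      · rintro ⟨hp, hpk⟩
        rwa [← hfix p hpk, e.mem_iff hM] at hp)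
  have hcex : Unanticipated M nums (vonNeumann k) k.toZFSet ℓ (vonNeumann o) A := by
    refine ⟨hkV, hkO, hA, ho.mono (Set.subset_univ _), ?_⟩
    rintro ⟨F, -, hF, hFA⟩
    obtain ⟨E, hEF, hE⟩ := hF.exists_restrict hM hoM (ZFSet.isTransitive_vonNeumann o) ho hpow
      subset_rfl
    exact hne ⟨E, hE, (hEF _ _).2 ⟨ho.pairClosed _ hkO _ hA, hFA⟩⟩
  obtain ⟨B, hBM, hB⟩ := hL1 _ (hlevel hot) A hA hcex
  obtain ⟨U, hU, ⟨hkU, hκU, hBU, hUc, hUn⟩, hmin⟩ := hL2 B hBM hB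
  have hUlevel := e.mem_j_level hM U hU
  have hUo : U.rank ≤ o := by
    by_contra hlt
    refine hmin _ (hlevel hot) ((hUlevel _ (he.sub _ ?_)).2 ?_) A hA hcex
    · rwa [ZFSet.rank_vonNeumann]
    · rwa [ZFSet.rank_vonNeumann, ← not_le]
  have hUV : U ⊆ vonNeumann o := ZFSet.subset_vonNeumann.2 hUo
  have hUt : U.IsTransitive := fun y hy z hz => (hUlevel z (hM _ (hoM _ (hUV hy)) _ hz)).2
    ((ZFSet.rank_lt_of_mem hz).trans (ZFSet.rank_lt_of_mem hy))
  have hseq : ∀ f : ℕ → ZFSet.{u}, (∀ n, f n ∈ U) → seq f ∈ M := fun f hf =>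
    hoM _ (ho.seq_mem trivial fun n => hUV (hf n))
  have hVt := ZFSet.isTransitive_vonNeumann.{u} o
  obtain ⟨E, hEU, hE⟩ := e.exists_extender hM he.fixNums hfix hUt hUc.pairClosed
    (fun x hx => hsub (ZFSet.mem_vonNeumann.2 ((ZFSet.mem_vonNeumann.1 (hUV hx)).trans hot))) hseq
  have hEV : E ⊆ vonNeumann o := fun p hp => by
    obtain ⟨u, hu, X, hX, rfl⟩ := hE.sub p hp
    exact ho.pairClosed _ (hUV hu) _ (hpow X hX)
  refine hUn ⟨E, he.sub E ((ZFSet.subset_vonNeumann.1 hEV).trans_lt hot),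
    (extenderIn_iff hM (fun X hX => hoM _ (hpow X hX))
      (fun f hf => hoM _ (ho.seq_mem trivial fun n => hEV (hf n)))
      (fun f hf => hoM _ (ho.seq_mem trivial fun n => hVt.mem_trans (hf n) hkV))).2 hE,
    (hEU _ _).2 ⟨hUc.pairClosed _ hκU _ hBU, hℓ, hB⟩⟩

/-- **(Gitik–Shelah)** If `κ` is a strong cardinal, then `LD^strong_κ` holds: there is a
partial function `ℓ : κ ⇀ V_κ` such that for every ordinal `θ` and every `A ∈ V_θ` there
is a `θ`-strongness embedding `j : V → M` with critical point `κ` and `j(ℓ)(κ) = A`. -/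
theorem gitik_shelah_LDstrong_of_strong (κ : ZFSet.{u}) (h : Strong κ) :
    LDstrong κ := by
  obtain ⟨hk, hκ⟩ := h.isStrong
  generalize κ.rank = k at hk hκ
  subst hκ
  have hkl : Order.IsSuccLimit k := by
    obtain ⟨M, e, he⟩ := hk 0
    exact he.isSuccLimit
  obtain ⟨ℓ, hℓ, hsub, hL⟩ := exists_isLaver hkl
  refine ⟨ℓ, hℓ, fun θ A hθ hA => ?_⟩
  obtain ⟨o, hto, ho⟩ := exists_closedIn (max k θ.rank)
  have hko : k < o := (le_max_left _ _).trans_lt hto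
  have hθo : θ.rank < o := (le_max_right _ _).trans_lt hto
  have hAo : A ∈ vonNeumann o := ZFSet.mem_vonNeumann.2 (lt_trans hA hθo)
  obtain ⟨E, hE, hEA⟩ := hL.exists_extender hk hsub hko ho hAo
  obtain ⟨M, e, he, -, heE⟩ := hE.exists_strongFor hkl hko ho
  exact ⟨⟨M, he.trans, e, he.crit, fun x hx => he.sub x (lt_trans hx hθo)⟩,
    heE _ (ho.pairClosed _ (ZFSet.mem_vonNeumann.2 (by rwa [Ordinal.rank_toZFSet])) _ hAo) _ hEA⟩
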